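/- arXiv:0908.4400 — 3 statements merged into one kernel-verified Lean document; each statement's English description precedes it below -/
import Mathlib

section
/- Let (f_n) be a sequence of log-concave densities on ℝ^d and let f be a probability density on ℝ^d such that f_n → f in distribution. Then f_n(x) → f(x) for Lebesgue-almost every x ∈ ℝ^d. -/
open MeasureTheory Filter

/-- A log-concave probability density on ℝ^d (with respect to Lebesgue measure). -/
def IsLogConcaveDensity {d : ℕ} (f : EuclideanSpace ℝ (Fin d) → ℝ) : Prop :=
  Measurable f ∧ (∀ x, 0 ≤ f x) ∧ (∫ x, f x = 1) ∧
    ∀ x y : EuclideanSpace ℝ (Fin d), ∀ s t : ℝ, 0 ≤ s → 0 ≤ t → s + t = 1 →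
      f x ^ s * f y ^ t ≤ f (s • x + t • y)

/-- A probability density on ℝ^d (with respect to Lebesgue measure). -/
def IsDensity {d : ℕ} (f : EuclideanSpace ℝ (Fin d) → ℝ) : Prop :=
  Measurable f ∧ (∀ x, 0 ≤ f x) ∧ (∫ x, f x = 1)

/-- Convergence in distribution of a sequence of densities to a density:
the integrals against every bounded continuous function converge. -/
def TendstoInDistribution {d : ℕ} (fs : ℕ → EuclideanSpace ℝ (Fin d) → ℝ)
    (f : EuclideanSpace ℝ (Fin d) → ℝ) : Prop :=
  ∀ g : EuclideanSpace ℝ (Fin d) → ℝ, Continuous g → (∃ M, ∀ x, |g x| ≤ M) →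
    Tendsto (fun n => ∫ x, g x * fs n x) atTop (nhds (∫ x, g x * f x))


open Metric Set Topology

section Convex

variable {E : Type*} [NormedAddCommGroup E] [InnerProductSpace ℝ E] [FiniteDimensional ℝ E]

theorem Convex.interior_closure_eq_of_finiteDimensional {C : Set E} (hC : Convex ℝ C) :
    interior (closure C) = interior C := by
  rcases (interior (closure C)).eq_empty_or_nonempty with h | h
  · rw [h]
    exact (subset_eq_empty (interior_mono subset_closure) h).symm
  · refine hC.interior_closure_eq_interior_of_nonempty_interior ?_
    rw [hC.interior_nonempty_iff_affineSpan_eq_top]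
    have hcl : closure C ⊆ affineSpan ℝ C :=
      closure_minimal (subset_affineSpan ℝ C) (affineSpan ℝ C).closed_of_finiteDimensional
    have := isOpen_interior.affineSpan_eq_top h
    exact top_unique (this ▸ affineSpan_le.2 (interior_subset.trans hcl))

theorem Convex.ball_subset_of_ball_subset_thickening {C : Set E} (hC : Convex ℝ C) {x : E}
    {ρ R : ℝ} (hρ : 0 < ρ) (h : ball x R ⊆ Metric.thickening ρ C) : ball x (R - ρ) ⊆ C := by
  suffices hcl : ball x (R - ρ) ⊆ closure C by
    have := interior_maximal hcl isOpen_ball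
    rw [hC.interior_closure_eq_of_finiteDimensional] at this
    exact this.trans interior_subset
  intro p hp
  by_contra hpC
  obtain ⟨ℓ, u, hℓC, hℓp⟩ := geometric_hahn_banach_closed_point hC.closure isClosed_closure hpC
  obtain ⟨w, rfl⟩ := (InnerProductSpace.toDual ℝ E).surjective ℓ
  simp only [InnerProductSpace.toDual_apply_apply] at hℓC hℓp
  have hpx : ‖p - x‖ < R - ρ := by simpa [dist_eq_norm] using hp
  have hw : w ≠ 0 := by
    rintro rfl
    have hx : x ∈ Metric.thickening ρ C := h (mem_ball_self (by linarith [norm_nonneg (p - x)]))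
    obtain ⟨a, ha, -⟩ := mem_thickening_iff.1 hx
    have := hℓC a (subset_closure ha)
    simp only [inner_zero_left] at this hℓp
    linarith
  have hw' : 0 < ‖w‖ := norm_pos_iff.2 hw
  have hq : p + (ρ / ‖w‖) • w ∈ ball x R := by
    rw [mem_ball, dist_eq_norm, add_sub_right_comm]
    refine (norm_add_le _ _).trans_lt ?_
    rw [norm_smul, Real.norm_of_nonneg (by positivity), div_mul_cancel₀ _ hw'.ne']
    linarith
  obtain ⟨a, ha, hqa⟩ := mem_thickening_iff.1 (h hq)
  rw [dist_eq_norm] at hqa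
  have h₁ := hℓC a (subset_closure ha)
  have h₂ := real_inner_le_norm w (p + (ρ / ‖w‖) • w - a)
  have h₃ : inner ℝ w (p + (ρ / ‖w‖) • w - a) = inner ℝ w p + ρ * ‖w‖ - inner ℝ w a := by
    rw [inner_sub_right, inner_add_right, inner_smul_right, real_inner_self_eq_norm_sq]
    field_simp
  have h₄ : ‖w‖ * ‖p + (ρ / ‖w‖) • w - a‖ ≤ ‖w‖ * ρ := by gcongr
  linarith

end Convex

/-- A continuous probability density supported on the ball of radius `R` around `x`. -/
structure IsMollifier {d : ℕ} (ψ : EuclideanSpace ℝ (Fin d) → ℝ) (x : EuclideanSpace ℝ (Fin d))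
    (R : ℝ) : Prop where
  continuous : Continuous ψ
  nonneg : ∀ y, 0 ≤ ψ y
  integral_eq_one : ∫ y, ψ y = 1
  support_eq : Function.support ψ = ball x R

namespace IsMollifier

variable {d : ℕ} {ψ : EuclideanSpace ℝ (Fin d) → ℝ} {x : EuclideanSpace ℝ (Fin d)} {R : ℝ}

theorem exists_bound (h : IsMollifier ψ x R) : ∃ M, ∀ y, |ψ y| ≤ M := by
  refine HasCompactSupport.exists_bound_of_continuous ?_ h.continuous
  exact (isCompact_closedBall x R).of_isClosed_subset (isClosed_tsupport ψ)
    (closure_minimal (h.support_eq.subset.trans ball_subset_closedBall) isClosed_closedBall)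

theorem integrable (h : IsMollifier ψ x R) : Integrable ψ :=
  integrable_of_integral_eq_one h.integral_eq_one

theorem integrable_mul (h : IsMollifier ψ x R) {f : EuclideanSpace ℝ (Fin d) → ℝ}
    (hf : Integrable f) : Integrable fun y ↦ ψ y * f y := by
  obtain ⟨M, hM⟩ := h.exists_bound
  exact hf.bdd_mul h.continuous.aestronglyMeasurable (ae_of_all _ hM)

theorem eq_zero (h : IsMollifier ψ x R) {y : EuclideanSpace ℝ (Fin d)} (hy : y ∉ ball x R) :
    ψ y = 0 := by
  rwa [← h.support_eq, Function.notMem_support] at hy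

theorem pos (h : IsMollifier ψ x R) (hR : 0 < R) : 0 < ψ x := by
  have : x ∈ Function.support ψ := h.support_eq ▸ mem_ball_self hR
  exact (h.nonneg x).lt_of_ne' this

theorem integral_mul_le (h : IsMollifier ψ x R) {f : EuclideanSpace ℝ (Fin d) → ℝ}
    (hf : Integrable f) {c : ℝ} (hc : ∀ y ∈ ball x R, f y ≤ c) : ∫ y, ψ y * f y ≤ c := by
  calc ∫ y, ψ y * f y ≤ ∫ y, ψ y * c := by
        refine integral_mono (h.integrable_mul hf) (h.integrable.mul_const c) fun y ↦ ?_
        by_cases hy : y ∈ ball x R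
        · exact mul_le_mul_of_nonneg_left (hc y hy) (h.nonneg y)
        · simp [h.eq_zero hy]
    _ = c := by rw [integral_mul_const, h.integral_eq_one, one_mul]

theorem le_integral_mul (h : IsMollifier ψ x R) {f : EuclideanSpace ℝ (Fin d) → ℝ}
    (hf : Integrable f) {c : ℝ} (hc : ∀ y ∈ ball x R, c ≤ f y) : c ≤ ∫ y, ψ y * f y := by
  have := h.integral_mul_le hf.neg (c := -c) fun y hy ↦ neg_le_neg (hc y hy)
  simp only [Pi.neg_apply, mul_neg, integral_neg] at this
  linarith

end IsMollifier

open scoped Convolution in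
theorem ae_exists_mollifier_tendsto {d : ℕ} {f : EuclideanSpace ℝ (Fin d) → ℝ}
    (hf : Integrable f) :
    ∀ᵐ x, ∃ (ψ : ℕ → EuclideanSpace ℝ (Fin d) → ℝ) (R : ℕ → ℝ),
      Tendsto R atTop (𝓝 0) ∧ (∀ k, 0 < R k) ∧ (∀ k, IsMollifier (ψ k) x (R k)) ∧
        Tendsto (fun k ↦ ∫ y, ψ k y * f y) atTop (𝓝 (f x)) := by
  let φ : ℕ → ContDiffBump (0 : EuclideanSpace ℝ (Fin d)) := fun k ↦
    { rIn := 1 / ((k : ℝ) + 1)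
      rOut := 2 * (1 / ((k : ℝ) + 1))
      rIn_pos := by positivity
      rIn_lt_rOut := lt_two_mul_self (by positivity) }
  have hφ : Tendsto (fun k ↦ (φ k).rOut) atTop (𝓝 0) := by
    simpa only [mul_zero] using (tendsto_one_div_add_atTop_nhds_zero_nat (𝕜 := ℝ)).const_mul 2
  filter_upwards [ContDiffBump.ae_convolution_tendsto_right_of_locallyIntegrable hφ (K := 2)
    (Eventually.of_forall fun k ↦ le_rfl) hf.locallyIntegrable] with x hx
  refine ⟨fun k y ↦ (φ k).normed volume (x - y), fun k ↦ (φ k).rOut, hφ, fun k ↦ (φ k).rOut_pos,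
    fun k ↦ ⟨?_, fun y ↦ (φ k).nonneg_normed _, ?_, ?_⟩, ?_⟩
  · exact (φ k).continuous_normed.comp (continuous_const.sub continuous_id)
  · rw [integral_sub_left_eq_self (fun y ↦ (φ k).normed volume y) volume x]
    exact (φ k).integral_normed
  · ext y
    have : x - y ∈ Function.support ((φ k).normed volume) ↔ y ∈ ball x (φ k).rOut := by
      rw [(φ k).support_normed_eq, mem_ball_zero_iff, mem_ball', dist_eq_norm]
    exact this
  · simpa only [convolution_lsmul_swap, smul_eq_mul] using hx

namespace IsLogConcaveDensity

variable {d : ℕ} {f : EuclideanSpace ℝ (Fin d) → ℝ}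

theorem nonneg (hf : IsLogConcaveDensity f) (x : EuclideanSpace ℝ (Fin d)) : 0 ≤ f x := hf.2.1 x

theorem integrable (hf : IsLogConcaveDensity f) : Integrable f :=
  integrable_of_integral_eq_one hf.2.2.1

theorem le_combo (hf : IsLogConcaveDensity f) {x y : EuclideanSpace ℝ (Fin d)} {s t a : ℝ}
    (hs : 0 ≤ s) (ht : 0 ≤ t) (hst : s + t = 1) (hx : a ≤ f x) (hy : a ≤ f y) :
    a ≤ f (s • x + t • y) := by
  rcases le_or_gt a 0 with ha | ha
  · exact ha.trans (hf.nonneg _)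
  · calc a = a ^ s * a ^ t := by rw [← Real.rpow_add ha, hst, Real.rpow_one]
      _ ≤ f x ^ s * f y ^ t := by
        have := hf.nonneg x
        gcongr
      _ ≤ _ := hf.2.2.2 x y s t hs ht hst

theorem convex_superlevel (hf : IsLogConcaveDensity f) (a : ℝ) : Convex ℝ {x | a ≤ f x} :=
  fun _ hx _ hy _ _ hs ht hst ↦ hf.le_combo hs ht hst hx hy

theorem mul_sq_volume_le (hf : IsLogConcaveDensity f) {x z : EuclideanSpace ℝ (Fin d)} {r c : ℝ}
    (hc : 0 ≤ c) (h : ∀ y ∈ ball z r, c ≤ f y) :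
    f x * c * volume.real (ball (0 : EuclideanSpace ℝ (Fin d)) (r / 2)) ^ 2 ≤ 1 := by
  set w := (1 / 2 : ℝ) • x + (1 / 2 : ℝ) • z
  have hlow : ∀ y ∈ ball w (r / 2), √(f x * c) ≤ f y := by
    intro y hy
    have hy' : (2 : ℝ) • y - x ∈ ball z r := by
      rw [mem_ball, dist_eq_norm] at hy ⊢
      have : (2 : ℝ) • y - x - z = (2 : ℝ) • (y - w) := by
        simp only [w]
        module
      rw [this, norm_smul, Real.norm_ofNat]
      linarith
    have := hf.2.2.2 x ((2 : ℝ) • y - x) (1 / 2) (1 / 2) (by norm_num) (by norm_num) (by norm_num)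
    rw [show (1 / 2 : ℝ) • x + (1 / 2 : ℝ) • ((2 : ℝ) • y - x) = y by module,
      ← Real.mul_rpow (hf.nonneg _) (hf.nonneg _), ← Real.sqrt_eq_rpow] at this
    refine le_trans (Real.sqrt_le_sqrt ?_) this
    exact mul_le_mul_of_nonneg_left (h _ hy') (hf.nonneg x)
  have hvol : √(f x * c) * volume.real (ball w (r / 2)) ≤ 1 := by
    calc _ ≤ ∫ y in ball w (r / 2), f y :=
          setIntegral_ge_of_const_le_real measurableSet_ball measure_ball_lt_top.ne hlow
            hf.integrable.integrableOn
      _ ≤ ∫ y, f y := setIntegral_le_integral hf.integrable (ae_of_all _ hf.nonneg)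
      _ = 1 := hf.2.2.1
  rw [Measure.addHaar_real_ball_center] at hvol
  have := pow_le_one₀ (n := 2) (by positivity) hvol
  rwa [mul_pow, Real.sq_sqrt (mul_nonneg (hf.nonneg x) hc)] at this

theorem concaveOn_log (hf : IsLogConcaveDensity f) {s : Set (EuclideanSpace ℝ (Fin d))}
    (hs : Convex ℝ s) (hpos : ∀ x ∈ s, 0 < f x) : ConcaveOn ℝ s fun x ↦ Real.log (f x) := by
  refine ⟨hs, fun x hx y hy a b ha hb hab ↦ ?_⟩
  have hx' := hpos x hx
  have hy' := hpos y hy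
  simp only [smul_eq_mul]
  rw [← Real.log_rpow hx', ← Real.log_rpow hy', ← Real.log_mul (by positivity) (by positivity)]
  exact Real.log_le_log (by positivity) (hf.2.2.2 x y a b ha hb hab)

theorem abs_sub_le (hf : IsLogConcaveDensity f) {x : EuclideanSpace ℝ (Fin d)} {r c M : ℝ}
    (hr : 0 < r) (hc : 0 < c) (hlow : ∀ y ∈ ball x r, c ≤ f y) (hup : ∀ y, f y ≤ M)
    {y : EuclideanSpace ℝ (Fin d)} (hy : y ∈ ball x (r / 2)) :
    |f y - f x| ≤ M * (2 * max |Real.log c| |Real.log M| / (r / 2)).toNNReal * dist y x := by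
  have hlip := (hf.concaveOn_log (convex_ball x r)
    fun y hy ↦ hc.trans_le (hlow y hy)).lipschitzOnWith_of_abs_le (half_pos hr)
    (M := max |Real.log c| |Real.log M|) fun y hy ↦
      abs_le_max_abs_abs (Real.log_le_log hc (hlow y hy))
        (Real.log_le_log (hc.trans_le (hlow y hy)) (hup y))
  rw [sub_half] at hlip
  have hx : x ∈ ball x (r / 2) := mem_ball_self (half_pos hr)
  have hd := hlip.dist_le_mul y hy x hx
  rw [Real.dist_eq] at hd
  have key : ∀ a b : ℝ, 0 < a → 0 < b → a ≤ M → a - b ≤ M * |Real.log a - Real.log b| := by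
    intro a b ha hb haM
    have h₁ := Real.log_le_sub_one_of_pos (div_pos hb ha)
    rw [Real.log_div hb.ne' ha.ne'] at h₁
    have h₂ : a * (b / a) = b := by field_simp
    calc a - b ≤ a * (Real.log a - Real.log b) := by nlinarith
      _ ≤ a * |Real.log a - Real.log b| := by gcongr; exact le_abs_self _
      _ ≤ _ := by gcongr
  have hpos : ∀ z ∈ ball x (r / 2), 0 < f z := fun z hz ↦
    hc.trans_le (hlow z (ball_subset_ball (half_le_self hr.le) hz))
  have hM : 0 ≤ M := (hf.nonneg x).trans (hup x)
  calc |f y - f x| ≤ M * |Real.log (f y) - Real.log (f x)| := by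
        refine abs_sub_le_iff.2 ⟨key _ _ (hpos y hy) (hpos x hx) (hup y), ?_⟩
        rw [abs_sub_comm]
        exact key _ _ (hpos x hx) (hpos y hy) (hup x)
    _ ≤ M * ((2 * max |Real.log c| |Real.log M| / (r / 2)).toNNReal * dist y x) := by gcongr
    _ = _ := by ring

end IsLogConcaveDensity

/-- The set of points near which the functions `fs n` do not become uniformly small. -/
def asymptoticSupport {d : ℕ} (fs : ℕ → EuclideanSpace ℝ (Fin d) → ℝ) :
    Set (EuclideanSpace ℝ (Fin d)) :=
  {y | ∀ ρ > 0, ∃ c > 0, ∀ᶠ n in atTop, ∃ z ∈ ball y ρ, c ≤ fs n z}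

section Sequence

variable {d : ℕ} {fs : ℕ → EuclideanSpace ℝ (Fin d) → ℝ} {f : EuclideanSpace ℝ (Fin d) → ℝ}
  {x : EuclideanSpace ℝ (Fin d)}

theorem convex_asymptoticSupport (hfs : ∀ n, IsLogConcaveDensity (fs n)) :
    Convex ℝ (asymptoticSupport fs) := by
  intro x hx y hy s t hs ht hst ρ hρ
  obtain ⟨a, ha, hxa⟩ := hx ρ hρ
  obtain ⟨b, hb, hyb⟩ := hy ρ hρ
  refine ⟨min a b, lt_min ha hb, ?_⟩
  filter_upwards [hxa, hyb] with n ⟨u, hu, hua⟩ ⟨v, hv, hvb⟩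
  refine ⟨s • u + t • v, ?_, (hfs n).le_combo hs ht hst ((min_le_left a b).trans hua)
    ((min_le_right a b).trans hvb)⟩
  rw [mem_ball, dist_eq_norm] at *
  calc ‖s • u + t • v - (s • x + t • y)‖ = ‖s • (u - x) + t • (v - y)‖ := by congr 1; module
    _ ≤ s * ‖u - x‖ + t * ‖v - y‖ := by
      refine (norm_add_le _ _).trans_eq ?_
      rw [norm_smul, norm_smul, Real.norm_of_nonneg hs, Real.norm_of_nonneg ht]
    _ < ρ := by
      rcases hs.eq_or_lt with rfl | hs'
      · obtain rfl : t = 1 := by linarith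
        simpa using hv
      · nlinarith [mul_lt_mul_of_pos_left hu hs', mul_le_mul_of_nonneg_left hv.le ht]

theorem eventually_le_on_ball_of_mem_interior (hfs : ∀ n, IsLogConcaveDensity (fs n))
    (hx : x ∈ interior (asymptoticSupport fs)) :
    ∃ r > 0, ∃ c > 0, ∀ᶠ n in atTop, ∀ y ∈ ball x r, c ≤ fs n y := by
  obtain ⟨R, hR, hball⟩ := nhds_basis_closedBall.mem_iff.1 (mem_interior_iff_mem_nhds.1 hx)
  have hρ : 0 < R / 4 := by positivity
  obtain ⟨t, ht, htf, hcover⟩ := finite_cover_balls_of_compact (isCompact_closedBall x R) hρ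
  have : ∃ c > 0, ∀ᶠ n in atTop, ∀ y ∈ t, ∃ z ∈ ball y (R / 4), c ≤ fs n z := by
    have hmem : ∀ y ∈ t, y ∈ asymptoticSupport fs := fun y hy ↦ hball (ht hy)
    clear hcover ht
    induction t, htf using Set.Finite.induction_on with
    | empty => exact ⟨1, one_pos, by simp⟩
    | @insert y t _ _ ih =>
      obtain ⟨a, ha, hta⟩ := ih fun y hy ↦ hmem y (mem_insert_of_mem _ hy)
      obtain ⟨b, hb, hyb⟩ := hmem y (mem_insert _ _) _ hρ
      refine ⟨min a b, lt_min ha hb, ?_⟩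
      filter_upwards [hta, hyb] with n hn ⟨u, hu, hub⟩ y' hy'
      rcases hy' with rfl | hy'
      · exact ⟨u, hu, (min_le_right a b).trans hub⟩
      · obtain ⟨v, hv, hva⟩ := hn y' hy'
        exact ⟨v, hv, (min_le_left a b).trans hva⟩
  obtain ⟨c, hc, hev⟩ := this
  refine ⟨R - R / 2, by linarith, c, hc, hev.mono fun n hn ↦ ?_⟩
  refine ((hfs n).convex_superlevel c).ball_subset_of_ball_subset_thickening (by positivity) ?_
  intro p hp
  obtain ⟨y, hy, hpy⟩ := mem_iUnion₂.1 (hcover (ball_subset_closedBall hp))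
  obtain ⟨z, hz, hcz⟩ := hn y hy
  refine mem_thickening_iff.2 ⟨z, hcz, ?_⟩
  rw [mem_ball] at hpy
  rw [mem_ball'] at hz
  linarith [dist_triangle p y z]

theorem integral_mollifier_eq_zero_of_notMem (hfs : ∀ n, IsLogConcaveDensity (fs n))
    (hf : IsDensity f) (hconv : TendstoInDistribution fs f)
    (hx : x ∉ asymptoticSupport fs) :
    ∃ ρ > 0, ∀ ψ R, R ≤ ρ → IsMollifier ψ x R → ∫ y, ψ y * f y = 0 := by
  simp only [asymptoticSupport, mem_ofPred_eq, not_forall, not_exists, not_and,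
    not_eventually] at hx
  obtain ⟨ρ, hρ, h⟩ := hx
  refine ⟨ρ, hρ, fun ψ R hR hψ ↦ ?_⟩
  have hlim := hconv ψ hψ.continuous hψ.exists_bound
  refine le_antisymm (le_of_forall_pos_le_add fun c hc ↦ ?_)
    (integral_nonneg fun y ↦ mul_nonneg (hψ.nonneg y) (hf.2.1 y))
  rw [zero_add]
  refine le_of_tendsto_of_frequently hlim ((h c hc).mono fun n hn ↦ ?_)
  exact hψ.integral_mul_le (hfs n).integrable fun y hy ↦
    (not_le.1 (hn y (ball_subset_ball hR hy))).le

theorem tendsto_zero_of_integral_mollifier_eq_zero (hfs : ∀ n, IsLogConcaveDensity (fs n))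
    (hconv : TendstoInDistribution fs f) {z : EuclideanSpace ℝ (Fin d)} {r c : ℝ}
    (hr : 0 < r) (hc : 0 < c) (hlow : ∀ᶠ n in atTop, ∀ y ∈ ball z r, c ≤ fs n y)
    {ψ : EuclideanSpace ℝ (Fin d) → ℝ} {R : ℝ} (hR : 0 < R) (hψ : IsMollifier ψ x R)
    (hzero : ∫ y, ψ y * f y = 0) : Tendsto (fun n ↦ fs n x) atTop (𝓝 0) := by
  have hlim := hconv ψ hψ.continuous hψ.exists_bound
  rw [hzero] at hlim
  have hx0 := hψ.pos hR
  obtain ⟨η, hη, hψη⟩ := Metric.eventually_nhds_iff_ball.1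
    (hψ.continuous.continuousAt.eventually (eventually_gt_nhds (half_lt_self hx0)))
  obtain ⟨t, ht0, ht1, htη⟩ : ∃ t : ℝ, 0 < t ∧ t ≤ 1 ∧ t * (‖z - x‖ + r) ≤ η := by
    have hD : 0 < ‖z - x‖ + r := by positivity
    refine ⟨min 1 (η / (‖z - x‖ + r)), by positivity, min_le_left _ _, ?_⟩
    exact (le_div_iff₀ hD).1 (min_le_right _ _)
  set w := (1 - t) • x + t • z
  set v := volume.real (ball w (t * r))
  have hv : 0 < v :=
    ENNReal.toReal_pos (measure_ball_pos _ _ (by positivity)).ne' measure_ball_lt_top.ne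
  have hbound : ∀ᶠ n in atTop, min (fs n x) c ≤ (∫ y, ψ y * fs n y) / (ψ x / 2 * v) := by
    filter_upwards [hlow] with n hn
    have hmin : 0 ≤ min (fs n x) c := le_min ((hfs n).nonneg x) hc.le
    have hpt : ∀ y ∈ ball w (t * r), ψ x / 2 * min (fs n x) c ≤ ψ y * fs n y := by
      intro y hy
      rw [mem_ball, dist_eq_norm] at hy
      have hyη : y ∈ ball x η := by
        rw [mem_ball, dist_eq_norm]
        calc ‖y - x‖ = ‖(y - w) + t • (z - x)‖ := by
              congr 1
              simp only [w]
              module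
          _ ≤ ‖y - w‖ + t * ‖z - x‖ := by
              refine (norm_add_le _ _).trans_eq ?_
              rw [norm_smul, Real.norm_of_nonneg ht0.le]
          _ < η := by linarith
      have hu : z + t⁻¹ • (y - w) ∈ ball z r := by
        rw [mem_ball, dist_eq_norm, add_sub_cancel_left, norm_smul,
          Real.norm_of_nonneg (by positivity), inv_mul_lt_iff₀ ht0]
        exact hy
      have := (hfs n).le_combo (sub_nonneg.2 ht1) ht0.le (sub_add_cancel 1 t)
        (min_le_left (fs n x) c) ((min_le_right (fs n x) c).trans (hn _ hu))
      rw [smul_add, smul_smul, mul_inv_cancel₀ ht0.ne', one_smul, ← add_assoc,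
        add_sub_cancel] at this
      exact mul_le_mul (hψη y hyη).le this hmin (hψ.nonneg y)
    rw [le_div_iff₀ (by positivity)]
    calc min (fs n x) c * (ψ x / 2 * v) = ψ x / 2 * min (fs n x) c * v := by ring
      _ ≤ ∫ y in ball w (t * r), ψ y * fs n y :=
          setIntegral_ge_of_const_le_real measurableSet_ball measure_ball_lt_top.ne hpt
            (hψ.integrable_mul (hfs n).integrable).integrableOn
      _ ≤ ∫ y, ψ y * fs n y := setIntegral_le_integral (hψ.integrable_mul (hfs n).integrable)
          (ae_of_all _ fun y ↦ mul_nonneg (hψ.nonneg y) ((hfs n).nonneg y))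
  have hmin : Tendsto (fun n ↦ min (fs n x) c) atTop (𝓝 0) := by
    refine tendsto_of_tendsto_of_tendsto_of_le_of_le' tendsto_const_nhds
      (by simpa using hlim.div_const (ψ x / 2 * v))
      (Eventually.of_forall fun n ↦ le_min ((hfs n).nonneg x) hc.le) hbound
  refine hmin.congr' ?_
  filter_upwards [hmin.eventually (eventually_lt_nhds hc)] with n hn
  exact min_eq_left ((min_lt_iff.1 hn).resolve_right (lt_irrefl c)).le

theorem tendsto_of_mem_interior_asymptoticSupport (hfs : ∀ n, IsLogConcaveDensity (fs n))
    (hconv : TendstoInDistribution fs f) (hx : x ∈ interior (asymptoticSupport fs))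
    {ψ : ℕ → EuclideanSpace ℝ (Fin d) → ℝ} {R : ℕ → ℝ} (hR : Tendsto R atTop (𝓝 0))
    (hψ : ∀ k, IsMollifier (ψ k) x (R k))
    (hlim : Tendsto (fun k ↦ ∫ y, ψ k y * f y) atTop (𝓝 (f x))) :
    Tendsto (fun n ↦ fs n x) atTop (𝓝 (f x)) := by
  obtain ⟨r, hr, c, hc, hlow⟩ := eventually_le_on_ball_of_mem_interior hfs hx
  set v := volume.real (ball (0 : EuclideanSpace ℝ (Fin d)) (r / 2))
  have hv : 0 < v :=
    ENNReal.toReal_pos (measure_ball_pos _ _ (by positivity)).ne' measure_ball_lt_top.ne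
  set M := 1 / (c * v ^ 2)
  set L := M * (2 * max |Real.log c| |Real.log M| / (r / 2)).toNNReal
  have hL : 0 ≤ L := by positivity
  have hosc : ∀ᶠ n in atTop, ∀ y ∈ ball x (r / 2), |fs n y - fs n x| ≤ L * dist y x := by
    filter_upwards [hlow] with n hn y hy
    refine (hfs n).abs_sub_le hr hc hn (fun y ↦ ?_) hy
    rw [le_div_iff₀ (by positivity), ← mul_assoc]
    exact (hfs n).mul_sq_volume_le hc.le hn
  rw [Metric.tendsto_nhds]
  intro ε hε
  have hLR : Tendsto (fun k ↦ L * R k) atTop (𝓝 0) := by simpa using hR.const_mul L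
  obtain ⟨k, hkr, hkL, hkf⟩ := ((hR.eventually (eventually_lt_nhds (half_pos hr))).and
    ((hLR.eventually (eventually_lt_nhds (by positivity : 0 < ε / 3))).and
      (Metric.tendsto_nhds.1 hlim (ε / 3) (by positivity)))).exists
  filter_upwards [hosc, Metric.tendsto_nhds.1
    (hconv (ψ k) (hψ k).continuous (hψ k).exists_bound) (ε / 3) (by positivity)] with n hn hnk
  have hosc' : ∀ y ∈ ball x (R k), |fs n y - fs n x| ≤ L * R k := fun y hy ↦
    (hn y (ball_subset_ball hkr.le hy)).trans (mul_le_mul_of_nonneg_left (le_of_lt hy) hL)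
  have hup := (hψ k).integral_mul_le (hfs n).integrable (c := fs n x + L * R k) fun y hy ↦ by
    linarith [(abs_le.1 (hosc' y hy)).2]
  have hdown := (hψ k).le_integral_mul (hfs n).integrable (c := fs n x - L * R k) fun y hy ↦ by
    linarith [(abs_le.1 (hosc' y hy)).1]
  rw [Real.dist_eq, abs_lt] at *
  constructor <;> linarith [hkf.1, hkf.2, hnk.1, hnk.2]

theorem nonempty_interior_asymptoticSupport (hfs : ∀ n, IsLogConcaveDensity (fs n))
    (hf : ∫ x, f x = 1) (hzero : ∀ᵐ x, x ∉ asymptoticSupport fs → f x = 0) :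
    (interior (asymptoticSupport fs)).Nonempty := by
  by_contra hempty
  rw [not_nonempty_iff_eq_empty] at hempty
  have hnull := (convex_asymptoticSupport hfs).addHaar_frontier volume
  rw [frontier, hempty, sdiff_empty] at hnull
  have : f =ᵐ[volume] 0 := by
    filter_upwards [hzero, measure_eq_zero_iff_ae_notMem.1 hnull] with x hx hxn
    exact hx fun h ↦ hxn (subset_closure h)
  rw [integral_congr_ae this] at hf
  simp at hf

end Sequence

/-- If a sequence of log-concave densities converges in distribution to a density `f`,
then it converges to `f` Lebesgue-almost everywhere. -/
theorem logConcave_tendstoInDistribution_ae_tendsto {d : ℕ}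
    (fs : ℕ → EuclideanSpace ℝ (Fin d) → ℝ) (hfs : ∀ n, IsLogConcaveDensity (fs n))
    (f : EuclideanSpace ℝ (Fin d) → ℝ) (hf : IsDensity f)
    (hconv : TendstoInDistribution fs f) :
    ∀ᵐ x, Tendsto (fun n => fs n x) atTop (nhds (f x)) := by
  have hpts := ae_exists_mollifier_tendsto (integrable_of_integral_eq_one hf.2.2)
  have hzero : ∀ᵐ x, x ∉ asymptoticSupport fs →
      f x = 0 ∧ ∃ ψ R, 0 < R ∧ IsMollifier ψ x R ∧ ∫ y, ψ y * f y = 0 := by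
    filter_upwards [hpts] with x ⟨ψ, R, hR, hRpos, hψ, hlim⟩ hx
    obtain ⟨ρ, hρ, h⟩ := integral_mollifier_eq_zero_of_notMem hfs hf hconv hx
    have hev : ∀ᶠ k in atTop, ∫ y, ψ k y * f y = 0 :=
      (hR.eventually (eventually_le_nhds hρ)).mono fun k hk ↦ h _ _ hk (hψ k)
    obtain ⟨k, hk⟩ := hev.exists
    exact ⟨tendsto_nhds_unique hlim (tendsto_const_nhds.congr' (hev.mono fun _ ↦ Eq.symm)),
      ψ k, R k, hRpos k, hψ k, hk⟩
  obtain ⟨z, hz⟩ := nonempty_interior_asymptoticSupport hfs hf.2.2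
    (hzero.mono fun x hx hxn ↦ (hx hxn).1)
  obtain ⟨r, hr, c, hc, hlow⟩ := eventually_le_on_ball_of_mem_interior hfs hz
  filter_upwards [hpts, hzero, measure_eq_zero_iff_ae_notMem.1
    ((convex_asymptoticSupport hfs).addHaar_frontier volume)] with
    x ⟨ψ, R, hR, _, hψ, hlim⟩ hx hfr
  by_cases hxi : x ∈ interior (asymptoticSupport fs)
  · exact tendsto_of_mem_interior_asymptoticSupport hfs hconv hxi hR hψ hlim
  · obtain ⟨hfx, ψ', R', hR', hψ', h0⟩ := hx fun h ↦ hfr ⟨subset_closure h, hxi⟩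
    rw [hfx]
    exact tendsto_zero_of_integral_mollifier_eq_zero hfs hconv hr hc hlow hR' hψ' h0
end

section
/- Let (f_n) be a sequence of log-concave densities on ℝ^d and let f be a log-concave density on ℝ^d such that f_n → f in distribution. Let a₀ > 0 and b₀ ∈ ℝ be such that f(x) ≤ exp(−a₀‖x‖ + b₀) for all x ∈ ℝ^d. Then for every a < a₀, ∫_{ℝ^d} e^{a‖x‖} |f_n(x) − f(x)| dx → 0 as n → ∞. -/
open MeasureTheory Filter

open scoped Topology

section ConvexGeometry

variable {E : Type*} [NormedAddCommGroup E] [InnerProductSpace ℝ E] [FiniteDimensional ℝ E]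

/-- There is a finite set of points such that every convex set meeting the `r / 4`-balls around
all of them contains the `r / 4`-ball around `x₀`. -/
lemma exists_finite_forall_convex_ball_subset (x₀ : E) {r : ℝ} (hr : 0 < r) :
    ∃ T ⊆ Metric.closedBall x₀ r, T.Finite ∧ ∀ C : Set E, Convex ℝ C →
      (∀ v ∈ T, ∃ y ∈ Metric.ball v (r / 4), y ∈ C) → Metric.ball x₀ (r / 4) ⊆ C := by
  obtain ⟨T, hTs, hTf, hcov⟩ := (isCompact_closedBall x₀ r).finite_cover_balls
    (show 0 < r / 4 by positivity)
  refine ⟨T, hTs, hTf, fun C hC hy p hp => ?_⟩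
  choose! y hyb hyC using hy
  refine convexHull_min (Set.image_subset_iff.2 hyC) hC ?_
  by_contra hph
  obtain ⟨φ, s, hφp, hφ⟩ := geometric_hahn_banach_point_closed (convex_convexHull ℝ (y '' T))
    ((hTf.image y).isClosed_convexHull ℝ) hph
  set u := (InnerProductSpace.toDual ℝ E).symm φ with hu
  have hφu : ∀ x, φ x = inner ℝ u x := fun x => by simp [hu]
  have key : ∀ v ∈ T, inner ℝ u p < inner ℝ u (y v) := fun v hv => by
    rw [← hφu, ← hφu]
    exact hφp.trans (hφ _ (subset_convexHull ℝ _ (Set.mem_image_of_mem y hv)))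
  have near : ∀ q ∈ Metric.closedBall x₀ r, ∃ v ∈ T, dist q v < r / 4 := fun q hq => by
    simpa using hcov hq
  have hu0 : u ≠ 0 := by
    intro h0
    obtain ⟨v, hv, -⟩ := near x₀ (Metric.mem_closedBall_self hr.le)
    simpa [h0] using key v hv
  have hun : 0 < ‖u‖ := norm_pos_iff.2 hu0
  obtain ⟨v, hv, hqv⟩ := near (x₀ - (r / ‖u‖) • u) (by
    simp [norm_smul, abs_of_pos hr, hun.ne'])
  have h1 := key v hv
  have h2 : ‖y v - (x₀ - (r / ‖u‖) • u)‖ ≤ r / 2 := by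
    have h3 := Metric.mem_ball.1 (hyb v hv)
    rw [← dist_eq_norm]
    rw [dist_comm] at hqv
    linarith [dist_triangle (y v) v (x₀ - (r / ‖u‖) • u)]
  have h4 := (real_inner_le_norm u (y v - (x₀ - (r / ‖u‖) • u))).trans
    (mul_le_mul_of_nonneg_left h2 hun.le)
  have h5 := (real_inner_le_norm u (x₀ - p)).trans
    (mul_le_mul_of_nonneg_left (show ‖x₀ - p‖ ≤ r / 4 by
      rw [← dist_eq_norm, dist_comm]; exact (Metric.mem_ball.1 hp).le) hun.le)
  rw [inner_sub_right, inner_sub_right, inner_smul_right, real_inner_self_eq_norm_sq] at h4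
  have h6 : r / ‖u‖ * ‖u‖ ^ 2 = r * ‖u‖ := by field_simp
  rw [h6] at h4
  rw [inner_sub_right] at h5
  nlinarith [mul_pos hr hun]

lemma integrable_exp_neg_mul_norm [MeasurableSpace E] [BorelSpace E] (μ : Measure E)
    [μ.IsAddHaarMeasure] {k : ℝ} (hk : 0 < k) : Integrable (fun x : E => Real.exp (-k * ‖x‖)) μ := by
  set m := Module.finrank ℝ E + 1
  have hint := integrable_one_add_norm (E := E) (μ := μ) (r := (m : ℝ)) (by simp [m])
  refine (hint.const_mul (Real.exp k * m.factorial / k ^ m)).mono'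
    (by fun_prop) (Eventually.of_forall fun x => ?_)
  have hx : 0 < 1 + ‖x‖ := by positivity
  rw [Real.norm_of_nonneg (Real.exp_pos _).le, Real.rpow_neg hx.le, Real.rpow_natCast]
  have h := Real.pow_div_factorial_le_exp (k * (1 + ‖x‖)) (by positivity) m
  rw [div_le_iff₀ (by positivity), mul_pow] at h
  have h2 : Real.exp (k * (1 + ‖x‖)) = Real.exp k * Real.exp (k * ‖x‖) := by
    rw [← Real.exp_add]; ring_nf
  rw [h2] at h
  rw [neg_mul, Real.exp_neg, ← div_eq_mul_inv, div_div, inv_eq_one_div,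
    div_le_div_iff₀ (by positivity) (by positivity)]
  linarith

lemma exists_bump [MeasurableSpace E] [BorelSpace E] (μ : Measure E)
    [μ.IsAddHaarMeasure] (v : E) {r : ℝ} (hr : 0 < r) :
    ∃ g : E → ℝ, Continuous g ∧ (∀ x, 0 ≤ g x) ∧ (∀ x, g x ≤ r) ∧
      (∀ x, x ∉ Metric.ball v r → g x = 0) ∧ Integrable g μ ∧ 0 < ∫ x, g x ∂μ := by
  have hc : Continuous (fun x : E => max 0 (r - dist x v)) := by fun_prop
  have hout : ∀ x, x ∉ Metric.ball v r → max 0 (r - dist x v) = 0 := fun x hx => by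
    rw [Metric.mem_ball, not_lt] at hx
    exact max_eq_left (by linarith)
  have hcs : HasCompactSupport (fun x : E => max 0 (r - dist x v)) :=
    HasCompactSupport.intro (isCompact_closedBall v r) fun x hx =>
      hout x fun h => hx (Metric.ball_subset_closedBall h)
  refine ⟨_, hc, fun x => le_max_left _ _, fun x => max_le hr.le (sub_le_self r dist_nonneg), hout, hc.integrable_of_hasCompactSupport hcs,
    hc.integral_pos_of_hasCompactSupport_nonneg_nonzero hcs (fun x => le_max_left _ _) (x := v) ?_⟩
  simp [hr.ne', hr.le]

end ConvexGeometry

section LogConcave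

variable {d : ℕ} {f : EuclideanSpace ℝ (Fin d) → ℝ} {fs : ℕ → EuclideanSpace ℝ (Fin d) → ℝ}

lemma IsLogConcaveDensity.integrable_s6 (hf : IsLogConcaveDensity f) : Integrable f := by
  by_contra h
  have := hf.2.2.1
  rw [integral_undef h] at this
  exact zero_ne_one this

lemma IsLogConcaveDensity.quasiconcaveOn (hf : IsLogConcaveDensity f) :
    QuasiconcaveOn ℝ Set.univ f := by
  rw [quasiconcaveOn_iff_min_le]
  refine ⟨convex_univ, fun x _ y _ s t hs ht hst => le_trans ?_ (hf.2.2.2 x y s t hs ht hst)⟩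
  have hm : 0 ≤ min (f x) (f y) := le_min (hf.2.1 x) (hf.2.1 y)
  calc min (f x) (f y) = min (f x) (f y) ^ s * min (f x) (f y) ^ t := by
        rw [← Real.rpow_add_of_nonneg hm hs ht, hst, Real.rpow_one]
    _ ≤ f x ^ s * f y ^ t := by
        gcongr
        · exact Real.rpow_nonneg (hf.2.1 x) s
        · exact min_le_left _ _
        · exact min_le_right _ _

/-- Almost every point lies in the interior of all superlevel sets that contain it at a rational
level. -/
lemma QuasiconcaveOn.ae_mem_interior {E : Type*} [NormedAddCommGroup E] [NormedSpace ℝ E]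
    [FiniteDimensional ℝ E] [MeasurableSpace E] [BorelSpace E] (μ : Measure E)
    [μ.IsAddHaarMeasure] {f : E → ℝ} (hf : QuasiconcaveOn ℝ Set.univ f) :
    ∀ᵐ x ∂μ, ∀ q : ℚ, (q : ℝ) < f x → x ∈ interior {y | (q : ℝ) < f y} := by
  rw [ae_all_iff]
  intro q
  have hC : Convex ℝ {y | (q : ℝ) < f y} := by simpa using hf.convex_gt (q : ℝ)
  filter_upwards [measure_eq_zero_iff_ae_notMem.1 (hC.addHaar_frontier μ)] with x hx hq
  by_contra hi
  exact hx ⟨subset_closure hq, hi⟩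

lemma TendstoInDistribution.eventually_exists_lt (hconv : TendstoInDistribution fs f)
    (hfi : Integrable f) (hfsi : ∀ n, Integrable (fs n)) {v : EuclideanSpace ℝ (Fin d)} {r c c' : ℝ}
    (hr : 0 < r) (hc : c < c') (hfc : ∀ x ∈ Metric.ball v r, c' ≤ f x) :
    ∀ᶠ n in atTop, ∃ y ∈ Metric.ball v r, c < fs n y := by
  obtain ⟨g, hgc, hg0, hgr, hgout, hgi, hgpos⟩ := exists_bump volume v hr
  have hgb : ∀ x, |g x| ≤ r := fun x => by rw [abs_of_nonneg (hg0 x)]; exact hgr x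
  have hmul : ∀ h : EuclideanSpace ℝ (Fin d) → ℝ, Integrable h →
      Integrable fun x => g x * h x := fun h hh =>
    hh.bdd_mul hgc.aestronglyMeasurable (Eventually.of_forall hgb)
  have hlow : c * ∫ x, g x < ∫ x, g x * f x := by
    refine (mul_lt_mul_of_pos_right hc hgpos).trans_le ?_
    rw [← integral_const_mul]
    refine integral_mono (hgi.const_mul _) (hmul f hfi) fun x => ?_
    by_cases hx : x ∈ Metric.ball v r
    · simpa [mul_comm] using mul_le_mul_of_nonneg_left (hfc x hx) (hg0 x)
    · simp [hgout x hx]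
  filter_upwards [(hconv g hgc ⟨r, hgb⟩).eventually_const_lt hlow] with n hn
  by_contra! hcon
  refine hn.not_ge ?_
  rw [← integral_const_mul]
  refine integral_mono (hmul _ (hfsi n)) (hgi.const_mul _) fun x => ?_
  by_cases hx : x ∈ Metric.ball v r
  · simpa [mul_comm] using mul_le_mul_of_nonneg_left (hcon x hx) (hg0 x)
  · simp [hgout x hx]

lemma TendstoInDistribution.neg (hconv : TendstoInDistribution fs f) :
    TendstoInDistribution (fun n x => -fs n x) (fun x => -f x) := fun g hg hM => by
  simpa [integral_neg] using (hconv g hg hM).neg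

lemma TendstoInDistribution.eventually_exists_gt (hconv : TendstoInDistribution fs f)
    (hfi : Integrable f) (hfsi : ∀ n, Integrable (fs n)) {v : EuclideanSpace ℝ (Fin d)} {r c c' : ℝ}
    (hr : 0 < r) (hc : c' < c) (hfc : ∀ x ∈ Metric.ball v r, f x ≤ c') :
    ∀ᶠ n in atTop, ∃ y ∈ Metric.ball v r, fs n y < c := by
  simpa using hconv.neg.eventually_exists_lt hfi.neg (fun n => (hfsi n).neg) hr (neg_lt_neg hc)
    fun x hx => neg_le_neg (hfc x hx)

lemma TendstoInDistribution.eventually_le_on_ball (hconv : TendstoInDistribution fs f)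
    (hf : IsLogConcaveDensity f) (hfs : ∀ n, IsLogConcaveDensity (fs n))
    {x₀ : EuclideanSpace ℝ (Fin d)} {c c' : ℝ} (hc : c < c')
    (hx₀ : x₀ ∈ interior {y | c' < f y}) :
    ∃ ρ > 0, ∀ᶠ n in atTop, ∀ x ∈ Metric.ball x₀ ρ, c ≤ fs n x := by
  obtain ⟨r, hr, hball⟩ := Metric.isOpen_iff.1 isOpen_interior x₀ hx₀
  obtain ⟨T, hTs, hTf, hT⟩ := exists_finite_forall_convex_ball_subset x₀ (half_pos hr)
  refine ⟨r / 2 / 4, by positivity, ?_⟩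
  have hall : ∀ᶠ n in atTop, ∀ v ∈ T, ∃ y ∈ Metric.ball v (r / 2 / 4), c < fs n y := by
    rw [eventually_all_finite hTf]
    intro v hv
    refine hconv.eventually_exists_lt hf.integrable_s6 (fun n => (hfs n).integrable_s6) (by positivity)
      hc fun x hx => ?_
    have h1 := Metric.mem_ball.1 hx
    have h2 := Metric.mem_closedBall.1 (hTs hv)
    have h3 : x ∈ interior {y | c' < f y} := hball (by
      rw [Metric.mem_ball]; linarith [dist_triangle x v x₀])
    have h4 : x ∈ {y | c' < f y} := interior_subset h3
    exact h4.le
  filter_upwards [hall] with n hn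
  have hC : Convex ℝ {x | c ≤ fs n x} := by simpa using (hfs n).quasiconcaveOn c
  exact fun x hx => hT _ hC (fun v hv => (hn v hv).imp fun y hy => ⟨hy.1, hy.2.le⟩) hx

lemma TendstoInDistribution.tendsto_integral_abs_sub (hconv : TendstoInDistribution fs f)
    (hf : IsLogConcaveDensity f) (hfs : ∀ n, IsLogConcaveDensity (fs n)) :
    Tendsto (fun n => ∫ x, |fs n x - f x|) atTop (𝓝 0) := by
  have hpos : Tendsto (fun n => ∫ x, max (f x - fs n x) 0) atTop (𝓝 0) := by
    rw [show 𝓝 (0 : ℝ) = 𝓝 (∫ _ : EuclideanSpace ℝ (Fin d), (0 : ℝ)) by rw [integral_zero]]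
    refine tendsto_integral_of_dominated_convergence f
      (fun n => ((hf.1.sub (hfs n).1).max measurable_const).aestronglyMeasurable) hf.integrable_s6
      (fun n => Eventually.of_forall fun x => ?_) ?_
    · rw [Real.norm_of_nonneg (le_max_right _ _)]
      exact max_le (by linarith [(hfs n).2.1 x]) (hf.2.1 x)
    · filter_upwards [hf.quasiconcaveOn.ae_mem_interior volume] with x hx
      refine tendsto_order.2 ⟨fun b hb => Eventually.of_forall fun n =>
        hb.trans_le (le_max_right _ _), fun b hb => ?_⟩
      obtain ⟨q, hq1, hq2⟩ := exists_rat_btwn (show f x - b < f x by linarith)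
      obtain ⟨c, hc1, hc2⟩ := exists_between hq1
      obtain ⟨ρ, hρ, hev⟩ := hconv.eventually_le_on_ball hf hfs hc2 (hx q hq2)
      filter_upwards [hev] with n hn
      have := hn x (Metric.mem_ball_self hρ)
      exact max_lt (by linarith) hb
  have heq : ∀ n, ∫ x, |fs n x - f x| = 2 * ∫ x, max (f x - fs n x) 0 := fun n => by
    have hpi : Integrable fun x => max (f x - fs n x) 0 :=
      (hf.integrable_s6.sub (hfs n).integrable_s6).pos_part
    have hsub : Integrable fun x => fs n x - f x := (hfs n).integrable_s6.sub hf.integrable_s6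
    have : ∀ x, |fs n x - f x| = (fs n x - f x) + 2 * max (f x - fs n x) 0 := fun x => by
      rcases le_total (f x) (fs n x) with h | h
      · rw [max_eq_right (by linarith), abs_of_nonneg (by linarith)]; ring
      · rw [max_eq_left (by linarith), abs_of_nonpos (by linarith)]; ring
    simp_rw [this]
    rw [integral_add hsub (hpi.const_mul 2),
      integral_sub (hfs n).integrable_s6 hf.integrable_s6, (hfs n).2.2.1, hf.2.2.1, integral_const_mul]
    ring
  simpa [heq] using hpos.const_mul 2

/-- If `f` is log-concave and at least `c` on the ball of radius `ρ` around `x₀`, then a point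
near the segment from `x₀` to `x` at which `f` is small controls `f x`. -/
lemma IsLogConcaveDensity.le_exp_of_near_segment (hf : IsLogConcaveDensity f)
    {x₀ x y : EuclideanSpace ℝ (Fin d)} {c ρ R a : ℝ} (hc : 0 < c) (hR : 0 < R)
    (hball : ∀ z ∈ Metric.ball x₀ ρ, c ≤ f z) (hx : 2 * R ≤ ‖x - x₀‖)
    (hy : ‖y - (x₀ + (R / ‖x - x₀‖) • (x - x₀))‖ < ρ / 2)
    (hfy : f y ≤ c * Real.exp (-a * R)) :
    f x ≤ c * Real.exp (-a * ‖x - x₀‖) := by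
  set D := ‖x - x₀‖ with hD
  have hDpos : 0 < D := by linarith
  set s := R / D with hs
  have hspos : 0 < s := by positivity
  have hs2 : s ≤ 1 / 2 := by rw [hs, div_le_iff₀ hDpos]; linarith
  have ht : 0 < 1 - s := by linarith
  set z := (1 - s)⁻¹ • (y - s • x) with hz
  have hzy : s • x + (1 - s) • z = y := by
    rw [hz, smul_inv_smul₀ ht.ne']; abel
  have hzx : z - x₀ = (1 - s)⁻¹ • (y - (x₀ + s • (x - x₀))) := by
    have : y - (x₀ + s • (x - x₀)) = (y - s • x) - (1 - s) • x₀ := by module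
    rw [this, smul_sub _ (y - s • x), inv_smul_smul₀ ht.ne']
  have hzb : z ∈ Metric.ball x₀ ρ := by
    rw [mem_ball_iff_norm, hzx, norm_smul, norm_inv, Real.norm_of_nonneg ht.le,
      inv_mul_lt_iff₀ ht]
    have : 0 < ρ := by linarith [norm_nonneg (y - (x₀ + s • (x - x₀)))]
    nlinarith
  have h1 := hf.2.2.2 x z s (1 - s) hspos.le ht.le (by ring)
  rw [hzy] at h1
  have h2 : f x ^ s * c ^ (1 - s) ≤ c * Real.exp (-a * R) :=
    (mul_le_mul_of_nonneg_left (Real.rpow_le_rpow hc.le (hball z hzb) ht.le)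
      (Real.rpow_nonneg (hf.2.1 x) s)).trans (h1.trans hfy)
  have h3 : c * Real.exp (-a * R) = (c * Real.exp (-a * D)) ^ s * c ^ (1 - s) := by
    rw [Real.mul_rpow hc.le (Real.exp_pos _).le, ← Real.exp_mul, mul_right_comm,
      ← Real.rpow_add hc]
    have : -a * D * s = -a * R := by rw [hs]; field_simp
    rw [this]; simp
  rw [h3] at h2
  exact (Real.rpow_le_rpow_iff (hf.2.1 x) (by positivity) hspos).1
    (le_of_mul_le_mul_right h2 (Real.rpow_pos_of_pos hc _))

lemma TendstoInDistribution.eventually_le_exp (hconv : TendstoInDistribution fs f)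
    (hf : IsLogConcaveDensity f) (hfs : ∀ n, IsLogConcaveDensity (fs n))
    {a₀ b₀ a : ℝ} (ha₀ : 0 < a₀) (hbound : ∀ x, f x ≤ Real.exp (-a₀ * ‖x‖ + b₀)) (ha : a < a₀)
    {x₀ : EuclideanSpace ℝ (Fin d)} {c ρ : ℝ} (hc : 0 < c) (hρ : 0 < ρ)
    (hball : ∀ᶠ n in atTop, ∀ x ∈ Metric.ball x₀ ρ, c ≤ fs n x) :
    ∃ R > 0, ∀ᶠ n in atTop, ∀ x, 2 * R ≤ ‖x - x₀‖ →
      fs n x ≤ c * Real.exp (-a * ‖x - x₀‖) := by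
  obtain ⟨R, hR⟩ := exists_gt (max 0 ((a₀ * (ρ / 4 + ‖x₀‖) + b₀ - Real.log c) / (a₀ - a)))
  obtain ⟨hR0, hR1⟩ := max_lt_iff.1 hR
  rw [div_lt_iff₀ (by linarith)] at hR1
  refine ⟨R, hR0, ?_⟩
  obtain ⟨T, hTs, hTf, hcov⟩ := (isCompact_sphere x₀ R).finite_cover_balls
    (show 0 < ρ / 4 by positivity)
  have hlt : Real.exp (-a₀ * (R - ρ / 4 - ‖x₀‖) + b₀) < c * Real.exp (-a * R) := by
    conv_rhs => rw [← Real.exp_log hc]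
    rw [← Real.exp_add, Real.exp_lt_exp]
    linarith
  have hall : ∀ᶠ n in atTop, ∀ v ∈ T, ∃ y ∈ Metric.ball v (ρ / 4),
      fs n y < c * Real.exp (-a * R) := by
    rw [eventually_all_finite hTf]
    intro v hv
    refine hconv.eventually_exists_gt hf.integrable_s6 (fun n => (hfs n).integrable_s6) (by positivity)
      hlt fun x hx => (hbound x).trans (Real.exp_le_exp.2 ?_)
    have h1 := mem_ball_iff_norm.1 hx
    have h2 := mem_sphere_iff_norm.1 (hTs hv)
    have h3 : v - x₀ = x - (x - v) - x₀ := by abel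
    have h4 : ‖v - x₀‖ ≤ ‖x‖ + ‖x - v‖ + ‖x₀‖ := by
      rw [h3]; exact (norm_sub_le _ _).trans (by gcongr; exact norm_sub_le _ _)
    nlinarith
  filter_upwards [hball, hall] with n hn hn' x hx
  have hD : 0 < ‖x - x₀‖ := by linarith
  have hp : x₀ + (R / ‖x - x₀‖) • (x - x₀) ∈ Metric.sphere x₀ R := by
    simp [norm_smul, abs_of_pos hR0, hD.ne']
  obtain ⟨v, hv, hpv⟩ : ∃ v ∈ T, dist (x₀ + (R / ‖x - x₀‖) • (x - x₀)) v < ρ / 4 := by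
    simpa using hcov hp
  obtain ⟨y, hyv, hy⟩ := hn' v hv
  refine (hfs n).le_exp_of_near_segment hc hR0 hn hx ?_ hy.le
  rw [← dist_eq_norm]
  rw [dist_comm] at hpv
  linarith [dist_triangle y v (x₀ + (R / ‖x - x₀‖) • (x - x₀)), Metric.mem_ball.1 hyv]

lemma IsLogConcaveDensity.exists_mem_interior (hf : IsLogConcaveDensity f) :
    ∃ x₀, ∃ c > 0, x₀ ∈ interior {y | c < f y} := by
  by_contra! hcon
  have hae : f =ᵐ[volume] 0 := by
    filter_upwards [hf.quasiconcaveOn.ae_mem_interior volume] with x hx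
    refine le_antisymm (le_of_not_gt fun hpos => ?_) (hf.2.1 x)
    obtain ⟨q, hq0, hq⟩ := exists_rat_btwn hpos
    exact hcon x q hq0 (hx q hq)
  have h := hf.2.2.1
  rw [integral_congr_ae hae] at h
  simp at h

/-- Uniform exponential decay of a weakly convergent sequence of log-concave densities. -/
lemma TendstoInDistribution.eventually_abs_sub_le_exp (hconv : TendstoInDistribution fs f)
    (hf : IsLogConcaveDensity f) (hfs : ∀ n, IsLogConcaveDensity (fs n))
    {a₀ b₀ a : ℝ} (ha₀ : 0 < a₀) (hbound : ∀ x, f x ≤ Real.exp (-a₀ * ‖x‖ + b₀)) (ha : a < a₀) :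
    ∃ C ≥ 0, ∃ S₀, ∀ᶠ n in atTop, ∀ x, S₀ ≤ ‖x‖ → |fs n x - f x| ≤ C * Real.exp (-a * ‖x‖) := by
  obtain ⟨x₀, c', hc', hx₀⟩ := hf.exists_mem_interior
  obtain ⟨ρ, hρ, hball⟩ := hconv.eventually_le_on_ball hf hfs (half_lt_self hc') hx₀
  obtain ⟨R, hR, hev⟩ := hconv.eventually_le_exp hf hfs ha₀ hbound ha (half_pos hc') hρ hball
  refine ⟨c' / 2 * Real.exp (|a| * ‖x₀‖) + Real.exp b₀, by positivity, 2 * R + ‖x₀‖, ?_⟩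
  filter_upwards [hev] with n hn x hx
  have h1 : fs n x ≤ c' / 2 * Real.exp (|a| * ‖x₀‖) * Real.exp (-a * ‖x‖) := by
    refine (hn x (by linarith [norm_sub_norm_le x x₀])).trans ?_
    rw [mul_assoc, ← Real.exp_add]
    gcongr
    have h2 : |a * (‖x‖ - ‖x - x₀‖)| ≤ |a| * ‖x₀‖ := by
      rw [abs_mul]
      gcongr
      simpa using abs_norm_sub_norm_le x (x - x₀)
    linarith [(abs_le.1 h2).2]
  have h3 : f x ≤ Real.exp b₀ * Real.exp (-a * ‖x‖) := by
    refine (hbound x).trans ?_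
    rw [← Real.exp_add, Real.exp_le_exp]
    nlinarith [norm_nonneg x]
  rw [add_mul]
  exact abs_le.2 ⟨by linarith [(hfs n).2.1 x, mul_nonneg (mul_nonneg (half_pos hc').le
    (Real.exp_pos (|a| * ‖x₀‖)).le) (Real.exp_pos (-a * ‖x‖)).le],
    by linarith [hf.2.1 x, mul_pos (Real.exp_pos b₀) (Real.exp_pos (-a * ‖x‖))]⟩

end LogConcave

/-- If a sequence of log-concave densities converges in distribution to a log-concave
density `f` with `f x ≤ exp (−a₀‖x‖ + b₀)`, then for every `a < a₀` the sequence
converges to `f` in the exponentially weighted total variation norm with weight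
`exp (a‖x‖)`. -/
theorem logConcave_tendstoInDistribution_weighted_L1 {d : ℕ}
    (fs : ℕ → EuclideanSpace ℝ (Fin d) → ℝ) (hfs : ∀ n, IsLogConcaveDensity (fs n))
    (f : EuclideanSpace ℝ (Fin d) → ℝ) (hf : IsLogConcaveDensity f)
    (hconv : TendstoInDistribution fs f)
    (a₀ : ℝ) (ha₀ : 0 < a₀) (b₀ : ℝ) (hbound : ∀ x, f x ≤ Real.exp (-a₀ * ‖x‖ + b₀))
    (a : ℝ) (ha : a < a₀) :
    Tendsto (fun n => ∫⁻ x, ENNReal.ofReal (Real.exp (a * ‖x‖) * |fs n x - f x|))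
      atTop (nhds 0) := by
  set δ := (a₀ - a) / 4 with hδ
  have hδpos : 0 < δ := by rw [hδ]; linarith
  obtain ⟨C, hC, S₀, hev⟩ := hconv.eventually_abs_sub_le_exp hf hfs ha₀ hbound
    (show a + 2 * δ < a₀ by rw [hδ]; linarith)
  have hexp := integrable_exp_neg_mul_norm (volume : Measure (EuclideanSpace ℝ (Fin d))) hδpos
  set J := ∫ x : EuclideanSpace ℝ (Fin d), Real.exp (-δ * ‖x‖)
  have hsub : ∀ n, Integrable fun x => |fs n x - f x| := fun n =>
    ((hfs n).integrable_s6.sub hf.integrable_s6).abs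
  have hmain : ∀ S, S₀ ≤ S → ∀ᶠ n in atTop,
      ∫⁻ x, ENNReal.ofReal (Real.exp (a * ‖x‖) * |fs n x - f x|) ≤
        ENNReal.ofReal (Real.exp (|a| * S) * (∫ x, |fs n x - f x|) +
          C * Real.exp (-δ * S) * J) := by
    intro S hS
    filter_upwards [hev] with n hn
    have hint : Integrable fun x => Real.exp (|a| * S) * |fs n x - f x| +
        C * Real.exp (-δ * S) * Real.exp (-δ * ‖x‖) :=
      ((hsub n).const_mul _).add (hexp.const_mul _)
    rw [← integral_const_mul, ← integral_const_mul,
      ← integral_add ((hsub n).const_mul _) (hexp.const_mul _),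
      ofReal_integral_eq_lintegral_ofReal hint (Eventually.of_forall fun x => by positivity)]
    refine lintegral_mono fun x => ENNReal.ofReal_le_ofReal ?_
    rcases le_total ‖x‖ S with hxS | hxS
    · have h1 : a * ‖x‖ ≤ |a| * S :=
        (mul_le_mul_of_nonneg_right (le_abs_self a) (norm_nonneg x)).trans
          (mul_le_mul_of_nonneg_left hxS (abs_nonneg a))
      have h2 : Real.exp (a * ‖x‖) * |fs n x - f x| ≤ Real.exp (|a| * S) * |fs n x - f x| := by
        gcongr
      have h3 : 0 ≤ C * Real.exp (-δ * S) * Real.exp (-δ * ‖x‖) := by positivity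
      linarith
    · have h1 : Real.exp (a * ‖x‖) * |fs n x - f x| ≤
          Real.exp (a * ‖x‖) * (C * Real.exp (-(a + 2 * δ) * ‖x‖)) := by
        gcongr
        exact hn x (hS.trans hxS)
      have h2 : Real.exp (a * ‖x‖) * (C * Real.exp (-(a + 2 * δ) * ‖x‖)) ≤
          C * Real.exp (-δ * S) * Real.exp (-δ * ‖x‖) := by
        rw [mul_left_comm, mul_assoc, ← Real.exp_add, ← Real.exp_add]
        refine mul_le_mul_of_nonneg_left (Real.exp_le_exp.2 ?_) hC
        nlinarith
      have h3 : 0 ≤ Real.exp (|a| * S) * |fs n x - f x| := by positivity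
      linarith
  have hS : Tendsto (fun S : ℝ => C * Real.exp (-δ * S) * J) atTop (nhds 0) := by
    have : Tendsto (fun S : ℝ => Real.exp (-δ * S)) atTop (nhds 0) :=
      Real.tendsto_exp_atBot.comp (tendsto_id.const_mul_atTop_of_neg (neg_neg_of_pos hδpos))
    simpa using (this.const_mul C).mul_const J
  refine ENNReal.tendsto_nhds_zero.2 fun ε hε => ?_
  obtain ⟨η, -, hη, hηε⟩ := ENNReal.lt_iff_exists_real_btwn.1 hε
  rw [ENNReal.ofReal_pos] at hη
  obtain ⟨S, hS1, hS2⟩ := ((hS.eventually_lt_const hη).and (eventually_ge_atTop S₀)).exists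
  have hlim : Tendsto (fun n => Real.exp (|a| * S) * (∫ x, |fs n x - f x|) +
      C * Real.exp (-δ * S) * J) atTop (nhds (C * Real.exp (-δ * S) * J)) := by
    simpa using ((hconv.tendsto_integral_abs_sub hf hfs).const_mul
      (Real.exp (|a| * S))).add_const (C * Real.exp (-δ * S) * J)
  filter_upwards [hmain S hS2, hlim.eventually_lt_const hS1] with n hn hn'
  exact hn.trans ((ENNReal.ofReal_le_ofReal hn'.le).trans hηε.le)
end

section
/- Let f₀ be a probability density on ℝ^d with ∫_{ℝ^d} ‖x‖ f₀(x) dx < ∞, ∫_{ℝ^d} f₀ log₊ f₀ dμ < ∞, and such that the support E of f₀ has nonempty interior. Then there exists a log-concave density f* on ℝ^d with d_KL(f₀, f*) = inf { d_KL(f₀, f) : f a log-concave density on ℝ^d }, and this infimum is finite. -/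
open MeasureTheory Filter Classical

/-- The Kullback–Leibler divergence `∫ f₀ log (f₀ / f) ∈ [0,∞]` of the density `f`
from the density `f₀`: it is `⊤` unless `f₀` vanishes a.e. where `f` does and the
integrand is integrable (its negative part is always integrable for densities, so
non-integrability can only come from the positive part). -/
noncomputable def klDiv {d : ℕ} (f₀ f : EuclideanSpace ℝ (Fin d) → ℝ) : ENNReal :=
  if Integrable (fun x => f₀ x * Real.log (f₀ x / f x)) ∧ (∀ᵐ x, f x = 0 → f₀ x = 0)
  then ENNReal.ofReal (∫ x, f₀ x * Real.log (f₀ x / f x))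
  else ⊤

open scoped ENNReal Topology

section LogConcaveProjection

variable {d : ℕ}

/-- The inequality expressing that `log f` is concave, for a nonnegative function `f`. -/
def IsLogConcave (f : EuclideanSpace ℝ (Fin d) → ℝ) : Prop :=
  ∀ x y : EuclideanSpace ℝ (Fin d), ∀ s t : ℝ, 0 ≤ s → 0 ≤ t → s + t = 1 →
    f x ^ s * f y ^ t ≤ f (s • x + t • y)

/-- The relative entropy of `f₀` with respect to `f` is finite. -/
def FiniteRelEntropy (f₀ f : EuclideanSpace ℝ (Fin d) → ℝ) : Prop :=
  Integrable (fun x => f₀ x * Real.log (f₀ x / f x)) ∧ (∀ᵐ x, f x = 0 → f₀ x = 0)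

/-- The relative entropy as a Bochner integral. -/
noncomputable def relEntropy (f₀ f : EuclideanSpace ℝ (Fin d) → ℝ) : ℝ :=
  ∫ x, f₀ x * Real.log (f₀ x / f x)

lemma sub_le_mul_log_div {a b : ℝ} (ha : 0 ≤ a) (hb : 0 ≤ b) (h : b = 0 → a = 0) :
    a - b ≤ a * Real.log (a / b) := by
  rcases ha.eq_or_lt with rfl | ha
  · simpa using hb
  have hb' : 0 < b := lt_of_le_of_ne hb fun h' => ha.ne' (h h'.symm)
  have h1 := Real.log_le_sub_one_of_pos (div_pos hb' ha)
  have h2 : Real.log (a / b) = - Real.log (b / a) := by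
    rw [← Real.log_inv, inv_div]
  have h3 := mul_le_mul_of_nonneg_left h1 ha.le
  have h4 : a * (b / a - 1) = b - a := by field_simp
  rw [h2]; linarith

lemma tendsto_mul_log_div {a b : ℝ} {u : ℕ → ℝ} (hu : Tendsto u atTop (𝓝 b))
    (hb : b = 0 → a = 0) :
    Tendsto (fun n => a * Real.log (a / u n) - a + u n) atTop
      (𝓝 (a * Real.log (a / b) - a + b)) := by
  by_cases ha : a = 0
  · subst ha; simpa using hu
  have hb' : b ≠ 0 := fun h => ha (hb h)
  exact ((((tendsto_const_nhds.div hu hb').log (div_ne_zero ha hb')).const_mul a).sub_const a).add hu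

lemma tendsto_mul_log_div_atTop {a : ℝ} {u : ℕ → ℝ} (ha : 0 < a) (hu₀ : ∀ n, 0 < u n)
    (hu : Tendsto u atTop (𝓝 0)) :
    Tendsto (fun n => a * Real.log (a / u n) - a + u n) atTop atTop := by
  have h1 : Tendsto u atTop (𝓝[>] 0) :=
    tendsto_nhdsWithin_iff.2 ⟨hu, Eventually.of_forall hu₀⟩
  have h2 : Tendsto (fun n => a / u n) atTop atTop := by
    simpa [div_eq_mul_inv] using (tendsto_inv_nhdsGT_zero.comp h1).const_mul_atTop ha
  have h3 := ((Real.tendsto_log_atTop.comp h2).const_mul_atTop ha).atTop_add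
    (tendsto_const_nhds (x := -a))
  simpa [sub_eq_add_neg] using h3.atTop_add hu

lemma integral_sub_add {k a b : EuclideanSpace ℝ (Fin d) → ℝ}
    (hk : Integrable k) (ha : Integrable a) (hb : Integrable b) :
    ∫ x, (k x - a x + b x) = (∫ x, k x) - (∫ x, a x) + ∫ x, b x := by
  rw [← integral_sub hk ha]
  exact integral_add (hk.sub ha) hb

lemma finiteRelEntropy_of_klDiv_lt_top {f₀ f : EuclideanSpace ℝ (Fin d) → ℝ}
    (h : klDiv f₀ f < ⊤) : FiniteRelEntropy f₀ f := by
  by_contra h'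
  exact h.ne (if_neg h')

lemma FiniteRelEntropy.klDiv_eq {f₀ f : EuclideanSpace ℝ (Fin d) → ℝ}
    (h : FiniteRelEntropy f₀ f) : klDiv f₀ f = ENNReal.ofReal (relEntropy f₀ f) :=
  if_pos h

lemma FiniteRelEntropy.integral_sub_le {f₀ f : EuclideanSpace ℝ (Fin d) → ℝ}
    (hf₀ : IsDensity f₀) (hf : Integrable f) (hfn : ∀ x, 0 ≤ f x)
    (h : FiniteRelEntropy f₀ f) : 1 - ∫ x, f x ≤ relEntropy f₀ f := by
  have hi := integrable_of_integral_eq_one hf₀.2.2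
  rw [← hf₀.2.2, ← integral_sub hi hf]
  refine integral_mono_ae (hi.sub hf) h.1 ?_
  filter_upwards [h.2] with x hx
  exact sub_le_mul_log_div (hf₀.2.1 x) (hfn x) hx

lemma integral_pos_of_ae_zero_imp {f₀ f : EuclideanSpace ℝ (Fin d) → ℝ}
    (hf₀ : IsDensity f₀) (hf : Integrable f) (hfn : ∀ x, 0 ≤ f x)
    (h : ∀ᵐ x, f x = 0 → f₀ x = 0) : 0 < ∫ x, f x := by
  refine lt_of_le_of_ne (integral_nonneg hfn) fun h0 => ?_
  have h1 := (integral_eq_zero_iff_of_nonneg hfn hf).1 h0.symm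
  have h2 : f₀ =ᵐ[volume] 0 := by
    filter_upwards [h, h1] with x hx hx'
    exact hx hx'
  have := hf₀.2.2
  rw [integral_congr_ae h2] at this
  simp at this

lemma IsLogConcave.isLogConcaveDensity_div {f : EuclideanSpace ℝ (Fin d) → ℝ}
    (hm : Measurable f) (hn : ∀ x, 0 ≤ f x) (hpos : 0 < ∫ x, f x) (h : IsLogConcave f) :
    IsLogConcaveDensity fun x => f x / ∫ y, f y := by
  refine ⟨hm.div_const _, fun x => div_nonneg (hn x) hpos.le, ?_, fun x y s t hs ht hst => ?_⟩
  · rw [integral_div, div_self hpos.ne']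
  · rw [Real.div_rpow (hn x) hpos.le, Real.div_rpow (hn y) hpos.le, div_mul_div_comm,
      ← Real.rpow_add hpos, hst, Real.rpow_one]
    exact div_le_div_of_nonneg_right (h x y s t hs ht hst) hpos.le

lemma FiniteRelEntropy.div_const {f₀ f : EuclideanSpace ℝ (Fin d) → ℝ}
    (hf₀ : IsDensity f₀) {c : ℝ} (hc : 0 < c) (h : FiniteRelEntropy f₀ f) :
    FiniteRelEntropy f₀ (fun x => f x / c) ∧
      relEntropy f₀ (fun x => f x / c) = relEntropy f₀ f + Real.log c := by
  have hi := integrable_of_integral_eq_one hf₀.2.2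
  have key : (fun x => f₀ x * Real.log (f₀ x / (f x / c))) =ᵐ[volume]
      fun x => f₀ x * Real.log (f₀ x / f x) + f₀ x * Real.log c := by
    filter_upwards [h.2] with x hx
    by_cases h0 : f₀ x = 0
    · simp [h0]
    · have hfx : f x ≠ 0 := fun h' => h0 (hx h')
      rw [div_div_eq_mul_div, mul_div_right_comm, Real.log_mul (div_ne_zero h0 hfx) hc.ne', mul_add]
  refine ⟨⟨(h.1.add (hi.mul_const _)).congr key.symm, ?_⟩, ?_⟩
  · filter_upwards [h.2] with x hx hx'
    exact hx ((div_eq_zero_iff.1 hx').resolve_right hc.ne')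
  · rw [relEntropy, integral_congr_ae key, integral_add h.1 (hi.mul_const _), integral_mul_const,
      hf₀.2.2, one_mul, relEntropy]

lemma isLogConcave_exp_neg_norm :
    IsLogConcave fun x : EuclideanSpace ℝ (Fin d) => Real.exp (-‖x‖) := by
  intro x y s t hs ht _
  simp only [← Real.exp_mul]
  rw [← Real.exp_add, Real.exp_le_exp]
  have h := norm_add_le (s • x) (t • y)
  rw [norm_smul, norm_smul, Real.norm_of_nonneg hs, Real.norm_of_nonneg ht] at h
  linarith

lemma integrable_exp_neg_norm_euclidean :
    Integrable fun x : EuclideanSpace ℝ (Fin d) => Real.exp (-‖x‖) := by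
  have h1 : Integrable fun x : EuclideanSpace ℝ (Fin d) => (1 + ‖x‖) ^ (-((d + 1 : ℕ) : ℝ)) :=
    integrable_one_add_norm (by simp)
  refine (h1.const_mul (((d + 1).factorial : ℝ) * Real.exp 1)).mono'
    (by fun_prop) (Eventually.of_forall fun x => ?_)
  have hx : 0 < 1 + ‖x‖ := by positivity
  have h2 := Real.pow_div_factorial_le_exp _ hx.le (d + 1)
  have hf : (0 : ℝ) < (d + 1).factorial := by positivity
  rw [Real.norm_of_nonneg (Real.exp_pos _).le, Real.rpow_neg hx.le, Real.rpow_natCast,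
    ← div_eq_mul_inv, le_div_iff₀ (by positivity)]
  rw [div_le_iff₀ hf] at h2
  calc Real.exp (-‖x‖) * (1 + ‖x‖) ^ (d + 1)
      ≤ Real.exp (-‖x‖) * (Real.exp (1 + ‖x‖) * (d + 1).factorial) := by gcongr
    _ = (d + 1).factorial * Real.exp 1 := by
        rw [← mul_assoc, ← Real.exp_add, mul_comm]; congr 2; ring

lemma finiteRelEntropy_exp_neg_norm {f₀ : EuclideanSpace ℝ (Fin d) → ℝ} (hf₀ : IsDensity f₀)
    (hmoment : Integrable (fun x => ‖x‖ * f₀ x))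
    (hlogplus : Integrable (fun x => f₀ x * max (Real.log (f₀ x)) 0)) :
    FiniteRelEntropy f₀ fun x => Real.exp (-‖x‖) := by
  have hm := hf₀.1
  have hi := integrable_of_integral_eq_one hf₀.2.2
  refine ⟨?_, Eventually.of_forall fun x hx => absurd hx (Real.exp_pos _).ne'⟩
  refine ((hlogplus.add hmoment).add integrable_exp_neg_norm_euclidean).mono'
    (Measurable.aestronglyMeasurable (by fun_prop)) (Eventually.of_forall fun x => ?_)
  have h0 := hf₀.2.1 x
  have hl := sub_le_mul_log_div h0 (Real.exp_pos (-‖x‖)).le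
    (fun h => absurd h (Real.exp_pos _).ne')
  have hp : 0 ≤ f₀ x * max (Real.log (f₀ x)) 0 := mul_nonneg h0 (le_max_right _ _)
  have hq : 0 ≤ ‖x‖ * f₀ x := by positivity
  have he := Real.exp_pos (-‖x‖)
  simp only [Pi.add_apply]
  rw [Real.norm_eq_abs, abs_le]
  constructor
  · linarith
  · rcases h0.eq_or_lt with h0' | h0'
    · rw [← h0']; simp [he.le]
    · rw [Real.log_div h0'.ne' he.ne', Real.log_exp]
      have := mul_le_mul_of_nonneg_left (le_max_left (Real.log (f₀ x)) 0) h0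
      linarith

lemma IsLogConcave.sqrt_mul {f g : EuclideanSpace ℝ (Fin d) → ℝ}
    (hfn : ∀ x, 0 ≤ f x) (hgn : ∀ x, 0 ≤ g x) (hf : IsLogConcave f) (hg : IsLogConcave g) :
    IsLogConcave fun x => √(f x) * √(g x) := by
  intro x y s t hs ht hst
  have key : ∀ {a : ℝ}, 0 ≤ a → ∀ r : ℝ, √a ^ r = √(a ^ r) := fun ha r => by
    rw [Real.sqrt_eq_rpow, Real.sqrt_eq_rpow, ← Real.rpow_mul ha, ← Real.rpow_mul ha, mul_comm]
  simp only
  rw [Real.mul_rpow (Real.sqrt_nonneg _) (Real.sqrt_nonneg _),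
    Real.mul_rpow (Real.sqrt_nonneg _) (Real.sqrt_nonneg _), key (hfn x), key (hgn x),
    key (hfn y), key (hgn y), mul_mul_mul_comm, ← Real.sqrt_mul (Real.rpow_nonneg (hfn x) _),
    ← Real.sqrt_mul (Real.rpow_nonneg (hgn x) _)]
  exact mul_le_mul (Real.sqrt_le_sqrt (hf x y s t hs ht hst))
    (Real.sqrt_le_sqrt (hg x y s t hs ht hst)) (Real.sqrt_nonneg _) (Real.sqrt_nonneg _)

lemma integrable_sqrt_mul_sqrt {f g : EuclideanSpace ℝ (Fin d) → ℝ}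
    (hfm : Measurable f) (hgm : Measurable g) (hfn : ∀ x, 0 ≤ f x) (hgn : ∀ x, 0 ≤ g x)
    (hf : Integrable f) (hg : Integrable g) : Integrable fun x => √(f x) * √(g x) := by
  refine (hf.add hg).mono' (Measurable.aestronglyMeasurable (by fun_prop))
    (Eventually.of_forall fun x => ?_)
  rw [Real.norm_of_nonneg (by positivity), Pi.add_apply]
  nlinarith [sq_nonneg (√(f x) - √(g x)), Real.sq_sqrt (hfn x), Real.sq_sqrt (hgn x), hfn x, hgn x]

lemma FiniteRelEntropy.sqrt_mul {f₀ f g : EuclideanSpace ℝ (Fin d) → ℝ}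
    (hfn : ∀ x, 0 ≤ f x) (hgn : ∀ x, 0 ≤ g x)
    (hf : FiniteRelEntropy f₀ f) (hg : FiniteRelEntropy f₀ g) :
    FiniteRelEntropy f₀ (fun x => √(f x) * √(g x)) ∧
      relEntropy f₀ (fun x => √(f x) * √(g x)) = (relEntropy f₀ f + relEntropy f₀ g) / 2 := by
  have key : (fun x => f₀ x * Real.log (f₀ x / (√(f x) * √(g x)))) =ᵐ[volume]
      fun x => (f₀ x * Real.log (f₀ x / f x) + f₀ x * Real.log (f₀ x / g x)) / 2 := by
    filter_upwards [hf.2, hg.2] with x hx hx'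
    by_cases h0 : f₀ x = 0
    · simp [h0]
    · have hfx : 0 < f x := lt_of_le_of_ne (hfn x) fun h' => h0 (hx h'.symm)
      have hgx : 0 < g x := lt_of_le_of_ne (hgn x) fun h' => h0 (hx' h'.symm)
      have h1 := (Real.sqrt_pos.2 hfx).ne'
      have h2 := (Real.sqrt_pos.2 hgx).ne'
      rw [Real.log_div h0 (mul_ne_zero h1 h2), Real.log_mul h1 h2, Real.log_sqrt hfx.le,
        Real.log_sqrt hgx.le, Real.log_div h0 hfx.ne', Real.log_div h0 hgx.ne']
      ring
  refine ⟨⟨((hf.1.add hg.1).div_const 2).congr key.symm, ?_⟩, ?_⟩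
  · filter_upwards [hf.2, hg.2] with x hx hx' h
    rcases mul_eq_zero.1 h with h | h
    · exact hx ((Real.sqrt_eq_zero (hfn x)).1 h)
    · exact hx' ((Real.sqrt_eq_zero (hgn x)).1 h)
  · rw [relEntropy, integral_congr_ae key, integral_div, integral_add hf.1 hg.1, relEntropy,
      relEntropy]

/-- Two nearly optimal log-concave densities are close in Hellinger distance. -/
lemma integral_sqrt_sub_sqrt_sq_le {f₀ f g : EuclideanSpace ℝ (Fin d) → ℝ} (hf₀ : IsDensity f₀)
    (hf : IsLogConcaveDensity f) (hg : IsLogConcaveDensity g)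
    (hkf : FiniteRelEntropy f₀ f) (hkg : FiniteRelEntropy f₀ g) {D : ℝ}
    (hD : ∀ h, IsLogConcaveDensity h → FiniteRelEntropy f₀ h → D ≤ relEntropy f₀ h) :
    Integrable (fun x => (√(f x) - √(g x)) ^ 2) ∧
      ∫ x, (√(f x) - √(g x)) ^ 2 ≤ relEntropy f₀ f + relEntropy f₀ g - 2 * D := by
  have hfi := integrable_of_integral_eq_one hf.2.2.1
  have hgi := integrable_of_integral_eq_one hg.2.2.1
  have hi := integrable_sqrt_mul_sqrt hf.1 hg.1 hf.2.1 hg.2.1 hfi hgi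
  have hn : ∀ x, 0 ≤ √(f x) * √(g x) := fun x => by positivity
  obtain ⟨hk, hke⟩ := hkf.sqrt_mul hf.2.1 hg.2.1 hkg
  have hpos := integral_pos_of_ae_zero_imp hf₀ hi hn hk.2
  have hm : Measurable fun x => √(f x) * √(g x) := hf.1.sqrt.mul hg.1.sqrt
  have hd := (IsLogConcave.sqrt_mul hf.2.1 hg.2.1 hf.2.2.2 hg.2.2.2).isLogConcaveDensity_div
    hm hn hpos
  obtain ⟨hk', hke'⟩ := hk.div_const hf₀ hpos
  have h1 := hD _ hd hk'
  rw [hke', hke] at h1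
  have h2 := Real.log_le_sub_one_of_pos hpos
  have heq : (fun x => (√(f x) - √(g x)) ^ 2) =
      fun x => f x - 2 * (√(f x) * √(g x)) + g x := by
    funext x
    rw [sub_sq, Real.sq_sqrt (hf.2.1 x), Real.sq_sqrt (hg.2.1 x)]
    ring
  rw [heq]
  refine ⟨(hfi.sub (hi.const_mul 2)).add hgi, ?_⟩
  rw [integral_sub_add hfi (hi.const_mul 2) hgi, integral_const_mul,
    hf.2.2.1, hg.2.2.1]
  linarith

/-- Lower semicontinuity of the relative entropy along almost everywhere convergent sequences of
densities. -/
lemma finiteRelEntropy_of_tendsto {f₀ G : EuclideanSpace ℝ (Fin d) → ℝ} (hf₀ : IsDensity f₀)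
    {f : ℕ → EuclideanSpace ℝ (Fin d) → ℝ} (hf : ∀ n, IsDensity (f n))
    (hk : ∀ n, FiniteRelEntropy f₀ (f n)) (hGm : Measurable G) (hGn : ∀ x, 0 ≤ G x)
    (hlim : ∀ᵐ x, Tendsto (fun n => f n x) atTop (𝓝 (G x))) {D : ℝ}
    (hD : Tendsto (fun n => relEntropy f₀ (f n)) atTop (𝓝 D)) :
    Integrable G ∧ FiniteRelEntropy f₀ G ∧ relEntropy f₀ G + ∫ x, G x ≤ D + 1 := by
  have hi := integrable_of_integral_eq_one hf₀.2.2
  have hm := hf₀.1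
  have hfi : ∀ n, Integrable (f n) := fun n => integrable_of_integral_eq_one (hf n).2.2
  have hfm : ∀ n, Measurable (f n) := fun n => (hf n).1
  have hGi : Integrable G := by
    refine ⟨hGm.aestronglyMeasurable, ?_⟩
    rw [hasFiniteIntegral_iff_ofReal (Eventually.of_forall hGn)]
    have h1 : (fun x => ENNReal.ofReal (G x)) =ᵐ[volume]
        fun x => liminf (fun n => ENNReal.ofReal (f n x)) atTop := by
      filter_upwards [hlim] with x hx
      exact (ENNReal.tendsto_ofReal hx).liminf_eq.symm
    rw [lintegral_congr_ae h1]
    refine (lintegral_liminf_le fun n => (hfm n).ennreal_ofReal).trans_lt ?_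
    simp_rw [← ofReal_integral_eq_lintegral_ofReal (hfi _)
      (Eventually.of_forall (hf _).2.1), (hf _).2.2]
    simp
  have hψi : ∀ n, Integrable fun x => f₀ x * Real.log (f₀ x / f n x) - f₀ x + f n x :=
    fun n => ((hk n).1.sub hi).add (hfi n)
  have hψn : ∀ n, 0 ≤ᵐ[volume] fun x => f₀ x * Real.log (f₀ x / f n x) - f₀ x + f n x := by
    intro n
    filter_upwards [(hk n).2] with x hx
    have := sub_le_mul_log_div (hf₀.2.1 x) ((hf n).2.1 x) hx
    simp only [Pi.zero_apply]
    linarith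
  have hψint : ∀ n, ∫ x, (f₀ x * Real.log (f₀ x / f n x) - f₀ x + f n x) =
      relEntropy f₀ (f n) := by
    intro n
    rw [integral_sub_add (hk n).1 hi (hfi n), hf₀.2.2, (hf n).2.2,
      relEntropy]
    ring
  have hfatou : ∫⁻ x, liminf (fun n => ENNReal.ofReal
      (f₀ x * Real.log (f₀ x / f n x) - f₀ x + f n x)) atTop ≤ ENNReal.ofReal D := by
    refine (lintegral_liminf_le fun n => by fun_prop).trans ?_
    simp_rw [← ofReal_integral_eq_lintegral_ofReal (hψi _) (hψn _), hψint]
    exact (ENNReal.tendsto_ofReal hD).liminf_eq.le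
  have hfin : ∀ᵐ x, liminf (fun n => ENNReal.ofReal
      (f₀ x * Real.log (f₀ x / f n x) - f₀ x + f n x)) atTop < ⊤ :=
    ae_lt_top (Measurable.liminf fun n => by fun_prop)
      (hfatou.trans_lt ENNReal.ofReal_lt_top).ne
  have hac : ∀ᵐ x, G x = 0 → f₀ x = 0 := by
    filter_upwards [hfin, hlim, ae_all_iff.2 fun n => (hk n).2] with x hx hl hz hG
    by_contra h0
    rw [hG] at hl
    have hpos : 0 < f₀ x := lt_of_le_of_ne (hf₀.2.1 x) (Ne.symm h0)
    have := tendsto_mul_log_div_atTop hpos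
      (fun n => lt_of_le_of_ne ((hf n).2.1 x) fun h => h0 (hz n h.symm)) hl
    exact hx.ne (ENNReal.tendsto_ofReal_atTop.comp this).liminf_eq
  have hGψn : 0 ≤ᵐ[volume] fun x => f₀ x * Real.log (f₀ x / G x) - f₀ x + G x := by
    filter_upwards [hac] with x hx
    have := sub_le_mul_log_div (hf₀.2.1 x) (hGn x) hx
    simp only [Pi.zero_apply]
    linarith
  have hle : ∫⁻ x, ENNReal.ofReal (f₀ x * Real.log (f₀ x / G x) - f₀ x + G x) ≤
      ENNReal.ofReal D := by
    refine le_trans (le_of_eq (lintegral_congr_ae ?_)) hfatou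
    filter_upwards [hlim, hac] with x hl hx
    exact (ENNReal.tendsto_ofReal (tendsto_mul_log_div hl hx)).liminf_eq.symm
  have hGψi : Integrable fun x => f₀ x * Real.log (f₀ x / G x) - f₀ x + G x := by
    refine ⟨Measurable.aestronglyMeasurable (by fun_prop), ?_⟩
    rw [hasFiniteIntegral_iff_ofReal hGψn]
    exact hle.trans_lt ENNReal.ofReal_lt_top
  have hki : Integrable fun x => f₀ x * Real.log (f₀ x / G x) := by
    refine ((hGψi.add hi).sub hGi).congr (Eventually.of_forall fun x => ?_)
    simp only [Pi.add_apply, Pi.sub_apply]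
    ring
  refine ⟨hGi, ⟨hki, hac⟩, ?_⟩
  have hD0 : 0 ≤ D := ge_of_tendsto' hD fun n => by
    rw [← hψint]; exact integral_nonneg_of_ae (hψn n)
  rw [← ofReal_integral_eq_lintegral_ofReal hGψi hGψn, ENNReal.ofReal_le_ofReal_iff hD0,
    integral_sub_add hki hi hGi, hf₀.2.2] at hle
  rw [relEntropy]
  linarith

/-- An almost everywhere convergent sequence of log-concave densities has a log-concave limit,
after modification on a null set. -/
lemma exists_isLogConcave_of_tendsto {f : ℕ → EuclideanSpace ℝ (Fin d) → ℝ}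
    (hf : ∀ n, IsLogConcaveDensity (f n))
    (hlim : ∀ᵐ x, ∃ l : ℝ, Tendsto (fun n => f n x) atTop (𝓝 l))
    (hne : ¬ ∀ᵐ x, Tendsto (fun n => f n x) atTop (𝓝 0)) :
    ∃ G : EuclideanSpace ℝ (Fin d) → ℝ, Measurable G ∧ (∀ x, 0 ≤ G x) ∧ IsLogConcave G ∧
      ∀ᵐ x, Tendsto (fun n => f n x) atTop (𝓝 (G x)) := by
  set L : EuclideanSpace ℝ (Fin d) → ℝ≥0∞ :=
    fun x => liminf (fun n => ENNReal.ofReal (f n x)) atTop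
  have hLm : Measurable L := Measurable.liminf fun n => (hf n).1.ennreal_ofReal
  have hLc : ∀ x y, ∀ s t : ℝ, 0 < s → 0 < t → s + t = 1 →
      L x ^ s * L y ^ t ≤ L (s • x + t • y) := by
    intro x y s t hs ht hst
    have hpow : ∀ (z) (r : ℝ), 0 < r →
        L z ^ r = liminf (fun n => ENNReal.ofReal (f n z) ^ r) atTop := fun z r hr =>
      (ENNReal.orderIsoRpow r hr).liminf_apply
    rw [hpow x s hs, hpow y t ht]
    refine ENNReal.le_liminf_mul.trans (liminf_le_liminf (Eventually.of_forall fun n => ?_))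
    simp only [Pi.mul_apply]
    rw [ENNReal.ofReal_rpow_of_nonneg ((hf n).2.1 x) hs.le,
      ENNReal.ofReal_rpow_of_nonneg ((hf n).2.1 y) ht.le,
      ← ENNReal.ofReal_mul (Real.rpow_nonneg ((hf n).2.1 x) _)]
    exact ENNReal.ofReal_le_ofReal ((hf n).2.2.2 x y s t hs.le ht.le hst)
  have hLlim : ∀ᵐ x, L x ≠ ⊤ ∧ Tendsto (fun n => f n x) atTop (𝓝 (L x).toReal) := by
    filter_upwards [hlim] with x ⟨l, hl⟩
    have h1 : L x = ENNReal.ofReal l := (ENNReal.tendsto_ofReal hl).liminf_eq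
    have h2 : 0 ≤ l := ge_of_tendsto' hl fun n => (hf n).2.1 x
    rw [h1, ENNReal.toReal_ofReal h2]
    exact ⟨ENNReal.ofReal_ne_top, hl⟩
  have hLtop : ∀ x, L x ≠ ⊤ := by
    intro x₀ hx₀
    apply hne
    have hnull : volume {x | L x = ⊤} = 0 := by
      have : ∀ᵐ x, L x ≠ ⊤ := hLlim.mono fun x hx => hx.1
      simpa [ae_iff] using this
    have hpre : volume ((fun y : EuclideanSpace ℝ (Fin d) => (1 / 2 : ℝ) • y) ⁻¹'
        ((fun z => (1 / 2 : ℝ) • x₀ + z) ⁻¹' {x | L x = ⊤})) = 0 := by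
      rw [Measure.addHaar_preimage_smul _ (by norm_num), measure_preimage_add, hnull, mul_zero]
    have hz : ∀ᵐ y, ¬ (L ((1 / 2 : ℝ) • x₀ + (1 / 2 : ℝ) • y) = ⊤) := by
      rw [ae_iff]; simpa using hpre
    filter_upwards [hz, hLlim] with y hy hly
    have hLy : L y = 0 := by
      by_contra h0
      apply hy
      have := hLc x₀ y (1 / 2) (1 / 2) (by norm_num) (by norm_num) (by norm_num)
      rw [hx₀, ENNReal.top_rpow_of_pos (by norm_num), ENNReal.top_mul] at this
      · exact top_le_iff.1 this
      · simp [ENNReal.rpow_eq_zero_iff, h0]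
    simpa [hLy] using hly.2
  refine ⟨fun x => (L x).toReal, hLm.ennreal_toReal, fun x => ENNReal.toReal_nonneg, ?_,
    hLlim.mono fun x hx => hx.2⟩
  intro x y s t hs ht hst
  rcases hs.eq_or_lt with rfl | hs
  · obtain rfl : t = 1 := by linarith
    simp
  rcases ht.eq_or_lt with rfl | ht
  · obtain rfl : s = 1 := by linarith
    simp
  simp only
  rw [ENNReal.toReal_rpow, ENNReal.toReal_rpow, ← ENNReal.toReal_mul]
  exact ENNReal.toReal_mono (hLtop _) (hLc x y s t hs ht hst)

/-- A sequence of log-concave densities approaching the minimal relative entropy geometrically fast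
converges almost everywhere. -/
lemma ae_exists_tendsto_of_relEntropy_lt {f₀ : EuclideanSpace ℝ (Fin d) → ℝ} (hf₀ : IsDensity f₀)
    {f : ℕ → EuclideanSpace ℝ (Fin d) → ℝ} (hf : ∀ n, IsLogConcaveDensity (f n))
    (hk : ∀ n, FiniteRelEntropy f₀ (f n)) {D : ℝ}
    (hD : ∀ h, IsLogConcaveDensity h → FiniteRelEntropy f₀ h → D ≤ relEntropy f₀ h)
    (hfD : ∀ n, relEntropy f₀ (f n) < D + (1 / 2) * ((1 / 2) ^ n) ^ 2) :
    ∀ᵐ x, ∃ l : ℝ, Tendsto (fun n => f n x) atTop (𝓝 l) := by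
  have hcau : ∀ N n m : ℕ, N ≤ n → N ≤ m →
      eLpNorm ((fun x => √(f n x)) - fun x => √(f m x)) 2 volume <
        ENNReal.ofReal ((1 / 2) ^ N) := by
    intro N n m hn hm
    obtain ⟨hi, hle⟩ := integral_sqrt_sub_sqrt_sq_le hf₀ (hf n) (hf m) (hk n) (hk m) hD
    have hmeas : Measurable fun x => √(f n x) - √(f m x) := (hf n).1.sqrt.sub (hf m).1.sqrt
    have hmem : MemLp (fun x => √(f n x) - √(f m x)) 2 :=
      (memLp_two_iff_integrable_sq hmeas.aestronglyMeasurable).2 hi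
    have hpow : ∀ k, N ≤ k → ((1 / 2 : ℝ) ^ k) ^ 2 ≤ ((1 / 2) ^ N) ^ 2 := fun k hk =>
      pow_le_pow_left₀ (by positivity)
        (pow_le_pow_of_le_one (by norm_num) (by norm_num) hk) 2
    have hlt : ∫ x, (√(f n x) - √(f m x)) ^ 2 < ((1 / 2) ^ N) ^ 2 := by
      linarith [hfD n, hfD m, hpow n hn, hpow m hm]
    change eLpNorm (fun x => √(f n x) - √(f m x)) 2 volume < _
    rw [hmem.eLpNorm_eq_integral_rpow_norm (by norm_num) (by norm_num)]
    refine (ENNReal.ofReal_lt_ofReal_iff (by positivity)).2 ?_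
    simp only [ENNReal.toReal_ofNat, Real.rpow_ofNat, Real.norm_eq_abs, sq_abs]
    rw [← one_div, ← Real.sqrt_eq_rpow]
    exact (Real.sqrt_lt' (by positivity)).2 hlt
  have hsum : ∑' N : ℕ, ENNReal.ofReal ((1 / 2 : ℝ) ^ N) ≠ ⊤ := by
    rw [← ENNReal.ofReal_tsum_of_nonneg (fun n => by positivity) summable_geometric_two]
    exact ENNReal.ofReal_ne_top
  filter_upwards [Lp.ae_tendsto_of_cauchy_eLpNorm
    (fun n => ((hf n).1.sqrt).aestronglyMeasurable) (by norm_num) hsum hcau] with x ⟨l, hl⟩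
  refine ⟨l ^ 2, (hl.pow 2).congr fun n => Real.sq_sqrt ((hf n).2.1 x)⟩

end LogConcaveProjection

/-- Existence of a log-concave density minimising the Kullback–Leibler divergence
from `f₀`, with finite minimal divergence, under finite first moment,
`∫ f₀ log₊ f₀ < ∞`, and nonempty interior of the support `E` of `f₀`. -/
theorem exists_klDiv_minimising_logConcave {d : ℕ}
    (f₀ : EuclideanSpace ℝ (Fin d) → ℝ) (hf₀ : IsDensity f₀)
    (hmoment : Integrable (fun x => ‖x‖ * f₀ x))
    (hlogplus : Integrable (fun x => f₀ x * max (Real.log (f₀ x)) 0))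
    (E : Set (EuclideanSpace ℝ (Fin d))) (hEclosed : IsClosed E)
    (hEint : ∫ x in E, f₀ x = 1)
    (hEmin : ∀ F, IsClosed F → (∫ x in F, f₀ x = 1) → E ⊆ F)
    (hEinterior : (interior E).Nonempty) :
    ∃ fstar : EuclideanSpace ℝ (Fin d) → ℝ, IsLogConcaveDensity fstar ∧
      (∀ g, IsLogConcaveDensity g → klDiv f₀ fstar ≤ klDiv f₀ g) ∧
      klDiv f₀ fstar < ⊤ := by
  have hw := finiteRelEntropy_exp_neg_norm hf₀ hmoment hlogplus
  have hwpos := integral_pos_of_ae_zero_imp hf₀ integrable_exp_neg_norm_euclidean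
    (fun x => (Real.exp_pos _).le) hw.2
  have hwd := isLogConcave_exp_neg_norm.isLogConcaveDensity_div (d := d)
    (by fun_prop) (fun x => (Real.exp_pos _).le) hwpos
  have hwk := (hw.div_const hf₀ hwpos).1
  have hRnonneg : ∀ h, IsLogConcaveDensity h → FiniteRelEntropy f₀ h → 0 ≤ relEntropy f₀ h := by
    intro h hh hk
    simpa [hh.2.2.1] using
      hk.integral_sub_le hf₀ (integrable_of_integral_eq_one hh.2.2.1) hh.2.1
  set S : Set ℝ := {r | ∃ h, IsLogConcaveDensity h ∧ FiniteRelEntropy f₀ h ∧ relEntropy f₀ h = r}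
  have hSne : S.Nonempty := ⟨_, _, hwd, hwk, rfl⟩
  have hSbdd : BddBelow S := ⟨0, by rintro _ ⟨h, hh, hk, rfl⟩; exact hRnonneg h hh hk⟩
  have hD : ∀ h, IsLogConcaveDensity h → FiniteRelEntropy f₀ h → sInf S ≤ relEntropy f₀ h :=
    fun h hh hk => csInf_le hSbdd ⟨h, hh, hk, rfl⟩
  have hseq : ∀ n : ℕ, ∃ h, IsLogConcaveDensity h ∧ FiniteRelEntropy f₀ h ∧
      relEntropy f₀ h < sInf S + (1 / 2) * ((1 / 2) ^ n) ^ 2 := by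
    intro n
    obtain ⟨_, ⟨h, hh, hk, rfl⟩, hlt⟩ := exists_lt_of_csInf_lt hSne
      (show sInf S < sInf S + (1 / 2) * ((1 / 2) ^ n) ^ 2 from lt_add_of_pos_right _ (by positivity))
    exact ⟨h, hh, hk, hlt⟩
  choose f hf hk hfD using hseq
  have hf' : ∀ n, IsDensity (f n) := fun n => ⟨(hf n).1, (hf n).2.1, (hf n).2.2.1⟩
  have hlimD : Tendsto (fun n => relEntropy f₀ (f n)) atTop (𝓝 (sInf S)) := by
    refine tendsto_of_tendsto_of_tendsto_of_le_of_le tendsto_const_nhds ?_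
      (fun n => hD _ (hf n) (hk n)) fun n => (hfD n).le
    have h1 : Tendsto (fun n : ℕ => (1 / 2 : ℝ) ^ n) atTop (𝓝 0) :=
      tendsto_pow_atTop_nhds_zero_of_lt_one (by norm_num) (by norm_num)
    simpa using ((h1.pow 2).const_mul (1 / 2 : ℝ)).const_add (sInf S)
  have hconv := ae_exists_tendsto_of_relEntropy_lt hf₀ hf hk hD hfD
  obtain ⟨G, hGm, hGn, hGc, hGlim⟩ := exists_isLogConcave_of_tendsto hf hconv fun h0 => by
    obtain ⟨hi, hk0, _⟩ := finiteRelEntropy_of_tendsto hf₀ hf' hk measurable_const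
      (fun _ => le_rfl) h0 hlimD
    simpa using integral_pos_of_ae_zero_imp hf₀ hi (fun _ => le_rfl) hk0.2
  obtain ⟨hGi, hGk, hGle⟩ := finiteRelEntropy_of_tendsto hf₀ hf' hk hGm hGn hGlim hlimD
  have hGpos := integral_pos_of_ae_zero_imp hf₀ hGi hGn hGk.2
  obtain ⟨hk', hke⟩ := hGk.div_const hf₀ hGpos
  refine ⟨_, hGc.isLogConcaveDensity_div hGm hGn hGpos, fun g hg => ?_, ?_⟩
  · rcases eq_or_ne (klDiv f₀ g) ⊤ with htop | htop
    · rw [htop]; exact le_top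
    · have hgk := finiteRelEntropy_of_klDiv_lt_top htop.lt_top
      rw [hk'.klDiv_eq, hgk.klDiv_eq, hke]
      refine ENNReal.ofReal_le_ofReal ?_
      linarith [hD g hg hgk, Real.log_le_sub_one_of_pos hGpos]
  · rw [hk'.klDiv_eq]
    exact ENNReal.ofReal_lt_top
end
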